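/- Let A be a simple (not necessarily unital) C*-algebra and let α : G → Aut(A) be an action of a finite group G on A with the weak tracial Rokhlin property. Then for every n ∈ ℕ and all positive elements a, b ∈ M_n(A) whose entries all lie in the fixed point algebra A^α, such that 0 is an accumulation point of sp(a) and 0 is an accumulation point of sp(b), if a is Cuntz equivalent to b in M_n(A), then a is Cuntz equivalent to b in M_n(A^α) (i.e., the witnessing sequences can be taken to have all entries in A^α). -/

import Mathlib

open Filter Topology

variable {A : Type*} [NonUnitalCStarAlgebra A] [PartialOrder A] [StarOrderedRing A]

/-- `(a - ε)₊`, the positive cut-down of `a`, obtained by applying the continuous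
functional calculus with the function `t ↦ max (t - ε) 0`. -/
noncomputable def cutdown (a : A) (ε : ℝ) : A :=
  cfcₙ (fun t : ℝ => max (t - ε) 0) a

/-- Cuntz subequivalence of `a` and `b`, with the witnessing sequence taken from `S`:
there is a sequence `(w n)` in `S` with `‖w n * b * (w n)⋆ - a‖ → 0`.
Taking `S = Set.univ` gives Cuntz subequivalence in `A`. -/
def CuntzLEIn (S : Set A) (a b : A) : Prop :=
  ∃ w : ℕ → A, (∀ n, w n ∈ S) ∧
    Tendsto (fun n => ‖w n * b * star (w n) - a‖) atTop (𝓝 0)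

/-- A C*-algebra is simple if it is nonzero and its only closed two-sided ideals
are `⊥` and `⊤`. -/
def IsSimpleCStarAlgebra (A : Type*) [NonUnitalCStarAlgebra A] : Prop :=
  (∃ a : A, a ≠ 0) ∧ ∀ I : TwoSidedIdeal A, IsClosed (I : Set A) → I = ⊥ ∨ I = ⊤

/-- The fixed point algebra of an action `α` of `G` on `A`. -/
def fixedPts {G : Type*} (α : G → A ≃⋆ₐ[ℂ] A) : Set A :=
  {a : A | ∀ g : G, α g a = a}

/-- The weak tracial Rokhlin property for an action of a finite group `G` on a simple
C*-algebra `A`: for every `ε > 0`, finite set `F ⊆ A`, and positive `x, y ∈ A` with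
`‖x‖ = 1` there are pairwise orthogonal positive contractions `f g` such that, with
`f = ∑ g, f g`: `f g` almost commutes with `F`, `α g (f h)` is close to `f (g * h)`,
`(y² - y f y - ε)₊ ≾_A x`, and `‖f x f‖ > 1 - ε`. -/
def WeakTracialRokhlin {G : Type*} [Group G] [Fintype G] (α : G → A ≃⋆ₐ[ℂ] A) : Prop :=
  ∀ (ε : ℝ), 0 < ε → ∀ (F : Finset A) (x y : A), 0 ≤ x → 0 ≤ y → ‖x‖ = 1 →
    ∃ f : G → A,
      (∀ g, 0 ≤ f g) ∧ (∀ g, ‖f g‖ ≤ 1) ∧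
      (∀ g h, g ≠ h → f g * f h = 0) ∧
      (∀ g, ∀ a ∈ F, ‖a * f g - f g * a‖ < ε) ∧
      (∀ g h, ‖α g (f h) - f (g * h)‖ < ε) ∧
      CuntzLEIn Set.univ (cutdown (y * y - y * (∑ g : G, f g) * y) ε) x ∧
      ‖(∑ g : G, f g) * x * (∑ g : G, f g)‖ > 1 - ε

/-- Cuntz subequivalence in the matrix algebra `Mₙ(A)`, with the witnessing sequence
taken from `S`: there is a sequence `(w k)` in `S` with `w k * b * (w k)⋆ → a`.
(Since all C*-norms on `Mₙ(A)` are equivalent to the product topology, this is norm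
convergence.)  Taking `S = Set.univ` gives Cuntz subequivalence in `Mₙ(A)`. -/
def CuntzLEMIn {n : ℕ} (S : Set (Matrix (Fin n) (Fin n) A))
    (a b : Matrix (Fin n) (Fin n) A) : Prop :=
  ∃ w : ℕ → Matrix (Fin n) (Fin n) A, (∀ k, w k ∈ S) ∧
    Tendsto (fun k => w k * b * star (w k)) atTop (𝓝 a)

theorem eq_zero_of_mul_mul_self_eq_zero {B : Type*} [NonUnitalCStarAlgebra B] {x : B}
    (hx : IsSelfAdjoint x) (h : x * x * x = 0) :
    x = 0 := by
  have h1 : star (x * x) * (x * x) = 0 := by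
    rw [star_mul, hx.star_eq, mul_assoc, ← mul_assoc x x x, h, mul_zero]
  have h2 : star x * x = 0 := by
    rw [hx.star_eq]; exact CStarRing.star_mul_self_eq_zero_iff _ |>.1 h1
  exact CStarRing.star_mul_self_eq_zero_iff _ |>.1 h2

/-- A simple C⋆-algebra is prime. -/
theorem IsSimpleCStarAlgebra.exists_mul_mul_ne_zero {B : Type*} [NonUnitalCStarAlgebra B]
    (hB : IsSimpleCStarAlgebra B) {p x : B} (hp : p ≠ 0) (hx : x ≠ 0) : ∃ q, p * q * x ≠ 0 := by
  by_contra! hall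
  let I : TwoSidedIdeal B := TwoSidedIdeal.mk' {c : B | ∀ q, p * q * c = 0}
    (by simp) (fun {c d} hc hd q => by rw [mul_add, hc, hd, add_zero])
    (fun {c} hc q => by rw [mul_neg, hc, neg_zero])
    (fun {d c} hc q => by rw [← mul_assoc, mul_assoc p]; exact hc _)
    (fun {c d} hc q => by rw [← mul_assoc, hc, zero_mul])
  have hmem (c : B) : c ∈ I ↔ ∀ q, p * q * c = 0 := TwoSidedIdeal.mem_mk' _ _ _ _ _ _ _
  have hI : (I : Set B) = ⋂ q, {c : B | p * q * c = 0} := by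
    ext c; simp [hmem]
  have hcl : IsClosed (I : Set B) := by
    rw [hI]
    exact isClosed_iInter fun q => isClosed_eq (by fun_prop) continuous_const
  rcases hB.2 I hcl with h | h
  · exact hx ((TwoSidedIdeal.mem_bot B).1 (h ▸ (hmem x).2 hall))
  · have h1 : ∀ c q, p * q * c = 0 := fun c => (hmem c).1 (by rw [h]; trivial)
    have h2 : star (p * star p) * (p * star p) = 0 := by
      rw [star_mul, star_star]; exact h1 _ _
    have h3 := CStarRing.star_mul_self_eq_zero_iff _ |>.1 h2
    exact hp (CStarRing.mul_star_self_eq_zero_iff _ |>.1 h3)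

/-- In a simple C⋆-algebra, finitely many nonzero positive elements dominate a common nonzero
positive element. -/
theorem IsSimpleCStarAlgebra.exists_common_conjugate (hA : IsSimpleCStarAlgebra A) {n : ℕ}
    (P : Fin n → A) (hP : ∀ i, 0 ≤ P i) (hP0 : ∀ i, P i ≠ 0) :
    ∃ x : A, 0 ≤ x ∧ x ≠ 0 ∧ ∀ i, ∃ q, x = q * P i * star q := by
  induction n with
  | zero =>
    obtain ⟨a, ha⟩ := hA.1
    exact ⟨star a * a, star_mul_self_nonneg a,
      fun h => ha (CStarRing.star_mul_self_eq_zero_iff _ |>.1 h), fun i => i.elim0⟩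
  | succ n ih =>
    obtain ⟨x, hx, hx0, hq⟩ := ih (fun i => P i.succ) (fun i => hP _) (fun i => hP0 _)
    obtain ⟨q, hq0⟩ := hA.exists_mul_mul_ne_zero (hP0 0) hx0
    have hxs : star x = x := (IsSelfAdjoint.of_nonneg hx).star_eq
    set r := CFC.sqrt (P 0) with hr
    have hrr : r * r = P 0 := CFC.sqrt_mul_sqrt_self _ (hP 0)
    have hrs : star r = r := (IsSelfAdjoint.of_nonneg (CFC.sqrt_nonneg _)).star_eq
    set y := x * star q * P 0 * q * x with hy
    have hyr : y = star (r * q * x) * (r * q * x) := by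
      simp only [hy, star_mul, hxs, hrs, ← hrr, mul_assoc]
    have hy0 : 0 ≤ y := hyr ▸ star_mul_self_nonneg _
    have hys : star y = y := (IsSelfAdjoint.of_nonneg hy0).star_eq
    have hyne : y ≠ 0 := fun h => hq0 <| by
      have := CStarRing.star_mul_self_eq_zero_iff _ |>.1 (hyr ▸ h)
      rw [← hrr, mul_assoc, mul_assoc, ← mul_assoc r q, this, mul_zero]
    set t := CFC.sqrt y with ht
    have htt : t * t = y := CFC.sqrt_mul_sqrt_self _ hy0
    have hts : star t = t := (IsSelfAdjoint.of_nonneg (CFC.sqrt_nonneg _)).star_eq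
    set k := CFC.sqrt x with hk
    have hkk : k * k = x := CFC.sqrt_mul_sqrt_self _ hx
    have hks : star k = k := (IsSelfAdjoint.of_nonneg (CFC.sqrt_nonneg _)).star_eq
    have hP0s : star (P 0) = P 0 := (IsSelfAdjoint.of_nonneg (hP 0)).star_eq
    refine ⟨y * y * y, (IsSelfAdjoint.of_nonneg hy0).conjugate_nonneg hy0,
      fun h => hyne (eq_zero_of_mul_mul_self_eq_zero hys h), Fin.cases ?_ fun i => ?_⟩
    · refine ⟨y * x * star q, ?_⟩
      rw [star_mul, star_mul, star_star, hxs, hys]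
      simp only [mul_assoc]
      congr 1
      simp only [hy, mul_assoc]
    · obtain ⟨p, hp⟩ := hq i
      have key : y * y * y = (t * x * star q * P 0 * q * k) * x *
          star (t * x * star q * P 0 * q * k) := by
        have e1 : y * y * y = t * (y * y) * t := by
          rw [← htt]; simp only [mul_assoc]
        rw [e1]
        have e2 : k * (x * k) = x * x := by
          nth_rw 1 [← hkk]; rw [← mul_assoc, ← mul_assoc, hkk, mul_assoc, hkk]
        have e3 (z : A) : k * (x * (k * z)) = x * (x * z) := by
          rw [← mul_assoc x k, ← mul_assoc k, e2, mul_assoc]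
        simp only [star_mul, star_star, hxs, hks, hts, hP0s, mul_assoc, e3]
        simp only [hy, mul_assoc]
      generalize t * x * star q * P 0 * q * k = W at key
      refine ⟨W * p, ?_⟩
      rw [key, star_mul]
      conv_lhs => rw [hp]
      simp only [mul_assoc]

/-- The iteration `s ↦ s + (x - s²) / 2`, started at `0`, which converges to the square root
of `x`. -/
noncomputable def sqrtIter {R : Type*} [NonUnitalRing R] [Module ℝ R] (x : R) : ℕ → R
  | 0 => 0
  | k + 1 => sqrtIter x k + (1 / 2 : ℝ) • (x - sqrtIter x k * sqrtIter x k)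

theorem sqrtIter_real_bounds {t : ℝ} (h0 : 0 ≤ t) (h1 : t ≤ 1) (k : ℕ) :
    0 ≤ sqrtIter t k ∧ sqrtIter t k ≤ √t ∧ √t - sqrtIter t k ≤ 2 / (k + 2) := by
  have hs0 := Real.sqrt_nonneg t
  have hs1 : √t ≤ 1 := Real.sqrt_le_one.2 h1
  have hss := Real.mul_self_sqrt h0
  induction k with
  | zero => simpa [sqrtIter] using hs1
  | succ k ih =>
    obtain ⟨i0, i1, i2⟩ := ih
    simp only [sqrtIter, smul_eq_mul]
    generalize sqrtIter t k = u at *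
    generalize √t = s at *
    subst hss
    refine ⟨by nlinarith, by nlinarith, ?_⟩
    have hk : (0 : ℝ) < k + 2 := by positivity
    have hb : (2 : ℝ) / (k + 2) ≤ 1 := by
      rw [div_le_one hk]; linarith [(Nat.cast_nonneg k : (0 : ℝ) ≤ k)]
    have hd : (2 : ℝ) / (k + 2) - (2 / (k + 2)) ^ 2 / 2 ≤ 2 / ((k + 1 : ℕ) + 2) := by
      push_cast
      rw [div_pow, div_div, div_sub_div _ _ (by positivity) (by positivity),
        div_le_div_iff₀ (by positivity) (by positivity)]
      have : (0 : ℝ) ≤ k := Nat.cast_nonneg k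
      nlinarith [mul_nonneg this this, mul_nonneg this (mul_nonneg this this)]
    generalize (2 : ℝ) / (k + 2) = e at *
    have he : s - u - (s - u) ^ 2 / 2 ≤ e - e ^ 2 / 2 := by
      nlinarith
    nlinarith

theorem sqrtIter_real_mul_self {t : ℝ} (h0 : 0 ≤ t) (h1 : t ≤ 1) (k : ℕ) :
    |sqrtIter t k * sqrtIter t k - t| ≤ 4 / (k + 2) := by
  obtain ⟨i0, i1, i2⟩ := sqrtIter_real_bounds h0 h1 k
  have hs0 := Real.sqrt_nonneg t
  have hs1 : √t ≤ 1 := Real.sqrt_le_one.2 h1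
  have hss := Real.mul_self_sqrt h0
  have h4 : (4 : ℝ) / (k + 2) = 2 * (2 / (k + 2)) := by ring
  rw [h4]
  generalize (2 : ℝ) / (k + 2) = e at *
  rw [abs_le]
  constructor <;> nlinarith

theorem continuous_sqrtIter_real (k : ℕ) : Continuous fun t : ℝ => sqrtIter t k := by
  induction k with
  | zero => exact continuous_const
  | succ k ih => simp only [sqrtIter, smul_eq_mul]; fun_prop

theorem sqrtIter_real_zero (k : ℕ) : sqrtIter (0 : ℝ) k = 0 := by
  induction k with
  | zero => rfl
  | succ k ih => simp [sqrtIter, ih]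

section sqrtIter

variable {B : Type*} [NonUnitalCStarAlgebra B]

theorem cfcₙ_sqrtIter {f : B} (hf : IsSelfAdjoint f) (k : ℕ) :
    cfcₙ (fun t : ℝ => sqrtIter t k) f = sqrtIter f k := by
  induction k with
  | zero => simp [sqrtIter]
  | succ k ih =>
    have hc := continuous_sqrtIter_real k
    have h0 := sqrtIter_real_zero k
    simp only [sqrtIter]
    rw [cfcₙ_add (fun t : ℝ => sqrtIter t k)
        (fun t : ℝ => (1 / 2 : ℝ) • (t - sqrtIter t k * sqrtIter t k)) f
        (by fun_prop) h0 (by fun_prop) (by simp [h0]),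
      cfcₙ_smul (1 / 2 : ℝ) (fun t : ℝ => t - sqrtIter t k * sqrtIter t k) f
        (by fun_prop) (by simp [h0]),
      cfcₙ_sub (fun t : ℝ => t) (fun t : ℝ => sqrtIter t k * sqrtIter t k) f
        (by fun_prop) rfl (by fun_prop) (by simp [h0]),
      cfcₙ_mul (fun t : ℝ => sqrtIter t k) (fun t : ℝ => sqrtIter t k) f
        (by fun_prop) h0 (by fun_prop) h0, ih, cfcₙ_id' ℝ f]

theorem isSelfAdjoint_sqrtIter {f : B} (hf : IsSelfAdjoint f) (k : ℕ) :
    IsSelfAdjoint (sqrtIter f k) :=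
  cfcₙ_sqrtIter hf k ▸ cfcₙ_predicate _ _

theorem map_sqrtIter (φ : B ≃⋆ₐ[ℂ] B) (f : B) (k : ℕ) :
    φ (sqrtIter f k) = sqrtIter (φ f) k := by
  induction k with
  | zero => simp [sqrtIter]
  | succ k ih =>
    have hr (x : B) : φ ((1 / 2 : ℝ) • x) = (1 / 2 : ℝ) • φ x := by
      rw [← Complex.coe_smul, map_smul, Complex.coe_smul]
    simp only [sqrtIter, map_add, hr, map_sub, map_mul, ih]

theorem sqrtIter_mul_eq_zero {f f' : B} (h : f * f' = 0) (k : ℕ) : sqrtIter f k * f' = 0 := by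
  induction k with
  | zero => simp [sqrtIter]
  | succ k ih => simp [sqrtIter, add_mul, sub_mul, smul_mul_assoc, mul_assoc, ih, h]

theorem mul_sqrtIter_eq_zero {f f' : B} (h : f' * f = 0) (k : ℕ) : f' * sqrtIter f k = 0 := by
  induction k with
  | zero => simp [sqrtIter]
  | succ k ih => simp [sqrtIter, mul_add, mul_sub, mul_smul_comm, ← mul_assoc, ih, h]

theorem norm_add_half_smul_sub_le (p q r : B) :
    ‖p + (1 / 2 : ℝ) • (q - r)‖ ≤ ‖p‖ + (‖q‖ + ‖r‖) / 2 := by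
  refine (norm_add_le _ _).trans ?_
  rw [norm_smul, Real.norm_of_nonneg (by norm_num : (0 : ℝ) ≤ 1 / 2)]
  linarith [norm_sub_le q r]

theorem norm_mul_add_mul_le {u c v : B} (hu : ‖u‖ ≤ 1) (hv : ‖v‖ ≤ 1) :
    ‖c * v + u * c‖ ≤ 2 * ‖c‖ := by
  have h1 := norm_mul_le c v
  have h2 := norm_mul_le u c
  have h3 := norm_add_le (c * v) (u * c)
  nlinarith [norm_nonneg c]

end sqrtIter

theorem quasispectrum_subset_Icc {f : A} (hf : 0 ≤ f) (hf1 : ‖f‖ ≤ 1) {t : ℝ}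
    (ht : t ∈ quasispectrum ℝ f) : 0 ≤ t ∧ t ≤ 1 := by
  refine ⟨quasispectrum_nonneg_of_nonneg f hf t ht, ?_⟩
  have h := norm_apply_le_norm_cfcₙ (fun x : ℝ => x) f ht
  rw [cfcₙ_id' ℝ f] at h
  exact (Real.le_norm_self t).trans (h.trans hf1)

theorem norm_sqrtIter_le {f : A} (hf : 0 ≤ f) (hf1 : ‖f‖ ≤ 1) (k : ℕ) : ‖sqrtIter f k‖ ≤ 1 := by
  rw [← cfcₙ_sqrtIter (IsSelfAdjoint.of_nonneg hf)]
  refine norm_cfcₙ_le fun t ht => ?_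
  obtain ⟨h0, h1⟩ := quasispectrum_subset_Icc hf hf1 ht
  obtain ⟨i0, i1, -⟩ := sqrtIter_real_bounds h0 h1 k
  rw [Real.norm_of_nonneg i0]
  exact i1.trans (Real.sqrt_le_one.2 h1)

theorem norm_sqrtIter_mul_self_sub_le {f : A} (hf : 0 ≤ f) (hf1 : ‖f‖ ≤ 1) (k : ℕ) :
    ‖sqrtIter f k * sqrtIter f k - f‖ ≤ 4 / (k + 2) := by
  have hc := continuous_sqrtIter_real k
  have h0 := sqrtIter_real_zero k
  have hfs := IsSelfAdjoint.of_nonneg hf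
  have : sqrtIter f k * sqrtIter f k - f =
      cfcₙ (fun t : ℝ => sqrtIter t k * sqrtIter t k - t) f := by
    rw [cfcₙ_sub (fun t : ℝ => sqrtIter t k * sqrtIter t k) (fun t : ℝ => t) f
        (by fun_prop) (by simp [h0]) (by fun_prop) rfl,
      cfcₙ_mul (fun t : ℝ => sqrtIter t k) (fun t : ℝ => sqrtIter t k) f
        (by fun_prop) h0 (by fun_prop) h0, cfcₙ_sqrtIter hfs, cfcₙ_id' ℝ f]
  rw [this]
  refine norm_cfcₙ_le fun t ht => ?_
  obtain ⟨h0, h1⟩ := quasispectrum_subset_Icc hf hf1 ht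
  exact sqrtIter_real_mul_self h0 h1 k

theorem norm_commutator_sqrtIter_le {f : A} (hf : 0 ≤ f) (hf1 : ‖f‖ ≤ 1) (a : A) (k : ℕ) :
    ‖a * sqrtIter f k - sqrtIter f k * a‖ ≤ 3 ^ k * ‖a * f - f * a‖ := by
  induction k with
  | zero => simp [sqrtIter]
  | succ k ih =>
    have hs := norm_sqrtIter_le hf hf1 k
    simp only [sqrtIter]
    generalize sqrtIter f k = s at *
    have e : a * (s + (1 / 2 : ℝ) • (f - s * s)) - (s + (1 / 2 : ℝ) • (f - s * s)) * a =
        (a * s - s * a) + (1 / 2 : ℝ) •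
          ((a * f - f * a) - ((a * s - s * a) * s + s * (a * s - s * a))) := by
      simp only [mul_add, add_mul, mul_smul_comm, smul_mul_assoc, mul_sub, sub_mul, smul_sub,
        smul_add, mul_assoc]
      abel
    rw [e]
    refine (norm_add_half_smul_sub_le _ _ _).trans ?_
    have h2 := norm_mul_add_mul_le (c := a * s - s * a) hs hs
    have h3 : (1 : ℝ) ≤ 3 ^ k := one_le_pow₀ (by norm_num)
    have h4 := norm_nonneg (a * f - f * a)
    rw [pow_succ]
    nlinarith

theorem norm_sqrtIter_sub_le {f f' : A} (hf : 0 ≤ f) (hf1 : ‖f‖ ≤ 1) (hf' : 0 ≤ f')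
    (hf1' : ‖f'‖ ≤ 1) (k : ℕ) :
    ‖sqrtIter f k - sqrtIter f' k‖ ≤ 3 ^ k * ‖f - f'‖ := by
  induction k with
  | zero => simp [sqrtIter]
  | succ k ih =>
    have hs := norm_sqrtIter_le hf hf1 k
    have hs' := norm_sqrtIter_le hf' hf1' k
    simp only [sqrtIter]
    generalize sqrtIter f k = s at *
    generalize sqrtIter f' k = s' at *
    have e : (s + (1 / 2 : ℝ) • (f - s * s)) - (s' + (1 / 2 : ℝ) • (f' - s' * s')) =
        (s - s') + (1 / 2 : ℝ) • ((f - f') - ((s - s') * s + s' * (s - s'))) := by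
      simp only [mul_sub, sub_mul, smul_sub, smul_add]
      abel
    rw [e]
    refine (norm_add_half_smul_sub_le _ _ _).trans ?_
    have h2 := norm_mul_add_mul_le (c := s - s') hs' hs
    have h3 : (1 : ℝ) ≤ 3 ^ k := one_le_pow₀ (by norm_num)
    have h4 := norm_nonneg (f - f')
    rw [pow_succ]
    nlinarith

theorem norm_cutdown_sub_le {c : A} (hc : 0 ≤ c) {ε : ℝ} (hε : 0 ≤ ε) :
    ‖cutdown c ε - c‖ ≤ ε := by
  have : cutdown c ε - c = cfcₙ (fun t : ℝ => max (t - ε) 0 - t) c := by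
    rw [cfcₙ_sub (fun t : ℝ => max (t - ε) 0) (fun t : ℝ => t) c (by fun_prop) (by simpa using hε)
        (by fun_prop) rfl, cfcₙ_id' ℝ c, cutdown]
  rw [this]
  refine norm_cfcₙ_le fun t ht => ?_
  have h0 := quasispectrum_nonneg_of_nonneg c hc t ht
  rw [Real.norm_eq_abs, abs_le]
  constructor
  · linarith [le_max_left (t - ε) 0]
  · linarith [max_le (by linarith : t - ε ≤ t) h0]

theorem norm_sum_le_one_of_orthogonal {ι : Type*} [Fintype ι] {f : ι → A} (hf : ∀ i, 0 ≤ f i)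
    (hf1 : ∀ i, ‖f i‖ ≤ 1) (horth : ∀ i j, i ≠ j → f i * f j = 0) : ‖∑ i, f i‖ ≤ 1 := by
  have h0 : 0 ≤ ∑ i, f i := Finset.sum_nonneg fun i _ => hf i
  have h1 : (∑ i, f i) * ∑ i, f i = ∑ i, f i * f i := by
    rw [Finset.sum_mul_sum]
    refine Finset.sum_congr rfl fun i _ => ?_
    rw [Finset.sum_eq_single i (fun j _ hj => horth i j hj.symm) (by simp)]
  have h2 : (∑ i, f i) * ∑ i, f i ≤ ∑ i, f i := by
    rw [h1]
    refine Finset.sum_le_sum fun i _ => ?_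
    have hs := IsSelfAdjoint.of_nonneg (hf i)
    have hid := cfcₙ_id' ℝ (f i)
    calc f i * f i = cfcₙ (fun t : ℝ => t * t) (f i) := by
          rw [cfcₙ_mul (fun t : ℝ => t) (fun t : ℝ => t) (f i), hid]
      _ ≤ cfcₙ (fun t : ℝ => t) (f i) := by
          refine cfcₙ_mono fun t ht => ?_
          obtain ⟨a0, a1⟩ := quasispectrum_subset_Icc (hf i) (hf1 i) ht
          nlinarith
      _ = f i := hid
  have hs : star (∑ i, f i) = ∑ i, f i := (IsSelfAdjoint.of_nonneg h0).star_eq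
  have h3 : ‖∑ i, f i‖ * ‖∑ i, f i‖ ≤ ‖∑ i, f i‖ := by
    rw [← CStarRing.norm_star_mul_self, hs]
    refine CStarAlgebra.norm_le_norm_of_nonneg_of_le ?_ h2
    nth_rw 1 [← hs]
    exact star_mul_self_nonneg _
  nlinarith [norm_nonneg (∑ i, f i)]

theorem CuntzLEIn.exists_norm_lt {B : Type*} [NonUnitalCStarAlgebra B] {S : Set B} {a b : B}
    (h : CuntzLEIn S a b) {ε : ℝ} (hε : 0 < ε) :
    ∃ w ∈ S, ‖w * b * star w - a‖ < ε := by
  obtain ⟨w, hw, hlim⟩ := h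
  obtain ⟨n, hn⟩ := (hlim.eventually (gt_mem_nhds hε)).exists
  exact ⟨w n, hw n, hn⟩

/-- A form of the weak tracial Rokhlin property in which the squares of the Rokhlin elements
nearly sum to one. -/
theorem WeakTracialRokhlin.exists_approx_sqrt {G : Type*} [Group G] [Fintype G]
    {α : G → A ≃⋆ₐ[ℂ] A} (hα : WeakTracialRokhlin α) {ε : ℝ} (hε : 0 < ε) (F : Finset A) {x y : A}
    (hx : 0 ≤ x) (hy : 0 ≤ y) (hx1 : ‖x‖ = 1) :
    ∃ (h : G → A) (s : A), (∀ g, IsSelfAdjoint (h g)) ∧ (∀ g, ‖h g‖ ≤ 1) ∧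
      (∀ g k, g ≠ k → h g * h k = 0) ∧ (∀ g, ∀ a ∈ F, ‖a * h g - h g * a‖ < ε) ∧
      (∀ g k, ‖α g (h k) - h (g * k)‖ < ε) ∧
      ‖s * x * star s - (y * y - y * (∑ g, h g * h g) * y)‖ < ε := by
  obtain ⟨k, hk⟩ : ∃ k : ℕ, ‖y‖ * (Fintype.card G * (4 / (k + 2))) * ‖y‖ < ε / 3 := by
    have : Tendsto (fun k : ℕ => ‖y‖ * (Fintype.card G * (4 / ((k : ℝ) + 2))) * ‖y‖) atTop
        (𝓝 (‖y‖ * (Fintype.card G * 0) * ‖y‖)) := by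
      refine ((Tendsto.const_mul _ (Tendsto.const_mul _ ?_)).mul_const _)
      exact tendsto_const_nhds.div_atTop
        (tendsto_atTop_add_const_right _ _ tendsto_natCast_atTop_atTop)
    simp only [mul_zero, zero_mul] at this
    exact (this.eventually (gt_mem_nhds (by positivity))).exists
  have hδ : 0 < ε / (3 * 3 ^ k) := by positivity
  have h3k : (1 : ℝ) ≤ 3 ^ k := one_le_pow₀ (by norm_num)
  have hδε : 3 ^ k * (ε / (3 * 3 ^ k)) = ε / 3 := by field_simp
  have hδ3 : ε / (3 * 3 ^ k) ≤ ε / 3 := by rw [← hδε]; nlinarith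
  generalize ε / (3 * 3 ^ k) = δ at *
  obtain ⟨f, hf0, hf1, horth, hcomm, htr, hle, -⟩ := hα δ hδ F x y hx hy hx1
  obtain ⟨s, -, hs⟩ := hle.exists_norm_lt (ε := ε / 3) (by positivity)
  refine ⟨fun g => sqrtIter (f g) k, s, fun g => isSelfAdjoint_sqrtIter (.of_nonneg (hf0 g)) k,
    fun g => norm_sqrtIter_le (hf0 g) (hf1 g) k, fun g g' hg => ?_, fun g a ha => ?_,
    fun g g' => ?_, ?_⟩
  · exact mul_sqrtIter_eq_zero (sqrtIter_mul_eq_zero (horth g g' hg) k) k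
  · refine (norm_commutator_sqrtIter_le (hf0 g) (hf1 g) a k).trans_lt ?_
    have := hcomm g a ha
    nlinarith
  · rw [map_sqrtIter]
    have hn : ‖α g (f g')‖ ≤ 1 := (NonUnitalStarAlgHom.norm_apply_le (α g) _).trans (hf1 g')
    have hp : 0 ≤ α g (f g') := map_nonneg (α g) (hf0 g')
    refine (norm_sqrtIter_sub_le hp hn (hf0 _) (hf1 _) k).trans_lt ?_
    have := htr g g'
    nlinarith
  · have hys : star y = y := (IsSelfAdjoint.of_nonneg hy).star_eq
    have hfs : 0 ≤ ∑ g, f g := Finset.sum_nonneg fun i _ => hf0 i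
    have hc : 0 ≤ y * y - y * (∑ g, f g) * y := by
      rw [sub_nonneg]
      have h1 := CStarAlgebra.star_left_conjugate_le_norm_smul (a := y) (b := ∑ g, f g)
        (IsSelfAdjoint.of_nonneg hfs)
      rw [hys] at h1
      refine h1.trans ?_
      have h2 : 0 ≤ y * y := by nth_rw 1 [← hys]; exact star_mul_self_nonneg y
      calc ‖∑ g, f g‖ • (y * y) ≤ (1 : ℝ) • (y * y) :=
            smul_le_smul_of_nonneg_right (norm_sum_le_one_of_orthogonal hf0 hf1 horth) h2
        _ = y * y := one_smul _ _
    have h1 := norm_cutdown_sub_le hc hδ.le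
    have h2 : ‖y * (∑ g, f g) * y - y * (∑ g, sqrtIter (f g) k * sqrtIter (f g) k) * y‖ < ε / 3 := by
      refine lt_of_le_of_lt ?_ hk
      rw [← sub_mul, ← mul_sub, ← Finset.sum_sub_distrib]
      refine (norm_mul_le _ _).trans ?_
      gcongr
      refine (norm_mul_le _ _).trans ?_
      gcongr
      refine (norm_sum_le _ _).trans ?_
      refine (Finset.sum_le_card_nsmul _ _ (4 / ((k : ℝ) + 2)) fun g _ => ?_).trans ?_
      · rw [norm_sub_rev]; exact norm_sqrtIter_mul_self_sub_le (hf0 g) (hf1 g) k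
      · simp
    have e : s * x * star s - (y * y - y * (∑ g, sqrtIter (f g) k * sqrtIter (f g) k) * y) =
        (s * x * star s - cutdown (y * y - y * (∑ g, f g) * y) δ) +
        (cutdown (y * y - y * (∑ g, f g) * y) δ - (y * y - y * (∑ g, f g) * y)) -
        (y * (∑ g, f g) * y - y * (∑ g, sqrtIter (f g) k * sqrtIter (f g) k) * y) := by
      abel
    rw [e]
    have h4 := norm_sub_le ((s * x * star s - cutdown (y * y - y * (∑ g, f g) * y) δ) +
        (cutdown (y * y - y * (∑ g, f g) * y) δ - (y * y - y * (∑ g, f g) * y)))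
        (y * (∑ g, f g) * y - y * (∑ g, sqrtIter (f g) k * sqrtIter (f g) k) * y)
    have h5 := norm_add_le (s * x * star s - cutdown (y * y - y * (∑ g, f g) * y) δ)
        (cutdown (y * y - y * (∑ g, f g) * y) δ - (y * y - y * (∑ g, f g) * y))
    linarith

/-- A single Rokhlin element which is far from annihilating a given fixed element, but nearly
orthogonal to its own translates. -/
theorem WeakTracialRokhlin.exists_nearly_orthogonal {B : Type*} [NonUnitalCStarAlgebra B]
    [PartialOrder B] {G : Type*} [Group G] [Fintype G] {α : G → B ≃⋆ₐ[ℂ] B}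
    (hα : WeakTracialRokhlin α) {m : B} (hm : m ∈ fixedPts α) (hm0 : 0 ≤ m) (hm1 : ‖m‖ = 1)
    {η : ℝ} (hη : 0 < η) :
    ∃ e : B, 0 ≤ e ∧ 1 / (2 * Fintype.card G : ℝ) ≤ ‖e * m * e‖ ∧
      ∀ g, g ≠ 1 → ‖e * m * α g e‖ ≤ η := by
  set N : ℝ := ((Fintype.card G : ℕ) : ℝ) with hN
  have hN1 : 1 ≤ N := by
    rw [hN]; exact_mod_cast Fintype.card_pos
  obtain ⟨ε, hε, hεη, hεN⟩ : ∃ ε : ℝ, 0 < ε ∧ 2 * ε ≤ η ∧ ε * (1 + 2 * N ^ 2) ≤ 1 / 2 := by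
    refine ⟨min (η / 2) (1 / 2 / (1 + 2 * N ^ 2)), by positivity, ?_, ?_⟩
    · linarith [min_le_left (η / 2) (1 / 2 / (1 + 2 * N ^ 2))]
    · rw [← le_div_iff₀ (by positivity)]
      exact min_le_right _ _
  obtain ⟨f, hf0, hf1, horth, hcomm, htr, -, hbig⟩ := hα ε hε {m} m 0 hm0 le_rfl hm1
  have hoff (g h : G) (hgh : g ≠ h) : ‖f g * m * f h‖ ≤ ε := by
    have e : f g * m * f h = -((m * f g - f g * m) * f h) := by
      rw [sub_mul, mul_assoc m, horth g h hgh]; simp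
    rw [e, norm_neg]
    refine (norm_mul_le _ _).trans ?_
    nlinarith [hcomm g m (by simp), hf1 h, norm_nonneg (f h), norm_nonneg (m * f g - f g * m)]
  have hdiag (g : G) : ‖f g * m * f g‖ ≤ ‖f 1 * m * f 1‖ + 2 * ε := by
    have h1 := htr g 1
    rw [mul_one] at h1
    have h2 : ‖α g (f 1) * m * α g (f 1)‖ = ‖f 1 * m * f 1‖ := by
      nth_rw 1 [← hm g]
      rw [← map_mul, ← map_mul]
      exact NonUnitalStarAlgHom.norm_map (α g) (EquivLike.injective _) _
    have h3 : ‖α g (f 1)‖ ≤ 1 := (NonUnitalStarAlgHom.norm_apply_le (α g) _).trans (hf1 1)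
    have e : f g * m * f g = α g (f 1) * m * α g (f 1) -
        ((α g (f 1) - f g) * m * α g (f 1) + f g * m * (α g (f 1) - f g)) := by
      simp only [sub_mul, mul_sub]; abel
    rw [e]
    have h4 : ‖(α g (f 1) - f g) * m * α g (f 1)‖ ≤ ε := by
      refine (norm_mul₃_le).trans ?_
      rw [hm1, mul_one]
      nlinarith [norm_nonneg (α g (f 1)), norm_nonneg (α g (f 1) - f g)]
    have h5 : ‖f g * m * (α g (f 1) - f g)‖ ≤ ε := by
      refine (norm_mul₃_le).trans ?_
      rw [hm1, mul_one]
      nlinarith [norm_nonneg (f g), norm_nonneg (α g (f 1) - f g), hf1 g]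
    have h6 := norm_sub_le (α g (f 1) * m * α g (f 1))
      ((α g (f 1) - f g) * m * α g (f 1) + f g * m * (α g (f 1) - f g))
    have h7 := norm_add_le ((α g (f 1) - f g) * m * α g (f 1)) (f g * m * (α g (f 1) - f g))
    linarith
  refine ⟨f 1, hf0 1, ?_, fun g hg => ?_⟩
  · have hrow (g : G) : ‖∑ h, f g * m * f h‖ ≤ ‖f 1 * m * f 1‖ + 2 * N * ε := by
      classical
      refine (norm_sum_le _ _).trans ?_
      have : ∀ h ∈ Finset.univ, ‖f g * m * f h‖ ≤ (if g = h then ‖f 1 * m * f 1‖ else 0) + 2 * ε := by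
        intro h _
        split_ifs with hgh
        · subst hgh; exact hdiag g
        · linarith [hoff g h hgh]
      refine (Finset.sum_le_sum this).trans ?_
      rw [Finset.sum_add_distrib, Finset.sum_ite_eq, if_pos (Finset.mem_univ _), Finset.sum_const,
        Finset.card_univ, nsmul_eq_mul]
      linarith
    have htot : ‖(∑ g, f g) * m * ∑ g, f g‖ ≤ N * (‖f 1 * m * f 1‖ + 2 * N * ε) := by
      rw [Finset.sum_mul, Finset.sum_mul]
      refine (norm_sum_le _ _).trans ?_
      refine (Finset.sum_le_card_nsmul _ _ (‖f 1 * m * f 1‖ + 2 * N * ε) fun g _ => ?_).trans ?_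
      · rw [Finset.mul_sum]; exact hrow g
      · rw [Finset.card_univ, nsmul_eq_mul]
    rw [div_le_iff₀ (by positivity)]
    nlinarith
  · have h1 := htr g 1
    rw [mul_one] at h1
    have e : f 1 * m * α g (f 1) = f 1 * m * (α g (f 1) - f g) + f 1 * m * f g := by
      rw [mul_sub]; abel
    rw [e]
    have h5 : ‖f 1 * m * (α g (f 1) - f g)‖ ≤ ε := by
      refine (norm_mul₃_le).trans ?_
      rw [hm1, mul_one]
      nlinarith [norm_nonneg (f 1), norm_nonneg (α g (f 1) - f g), hf1 1]
    linarith [norm_add_le (f 1 * m * (α g (f 1) - f g)) (f 1 * m * f g), hoff 1 g hg.symm]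

/-- Compressing a fixed positive element so that the cross terms with the translates are
dominated, uniformly over further compressions, by the diagonal term. -/
theorem WeakTracialRokhlin.exists_compression {G : Type*} [Group G] [Fintype G]
    {α : G → A ≃⋆ₐ[ℂ] A} (hα : WeakTracialRokhlin α) {m : A} (hm : m ∈ fixedPts α) (hm0 : 0 ≤ m)
    (hm1 : m ≠ 0) {μ : ℝ} (hμ : 0 < μ) :
    ∃ u : A, star u * m * u ≠ 0 ∧ ∀ z g, g ≠ 1 →
      ‖z * star u * m * α g (u * star z)‖ ≤ μ * ‖z * (star u * m * u) * star z‖ := by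
  wlog hm2 : ‖m‖ = 1 generalizing m
  · have hn : ‖m‖ ≠ 0 := norm_ne_zero_iff.2 hm1
    have hn0 : 0 ≤ ‖m‖⁻¹ := by positivity
    obtain ⟨u, hu, hz⟩ := this (m := ‖m‖⁻¹ • m)
      (fun g => by rw [← Complex.coe_smul, map_smul, hm g]) (smul_nonneg hn0 hm0)
      (smul_ne_zero (inv_ne_zero hn) hm1) (by rw [norm_smul, norm_inv, norm_norm, inv_mul_cancel₀ hn])
    simp only [mul_smul_comm, smul_mul_assoc, norm_smul, mul_left_comm μ] at hu hz
    refine ⟨u, fun h => hu (by rw [h, smul_zero]), fun z g hg => ?_⟩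
    exact le_of_mul_le_mul_left (hz z g hg) (norm_pos_iff.2 (inv_ne_zero hn))
  set δ : ℝ := 1 / (2 * (2 * Fintype.card G)) with hδ
  have hcard : (0 : ℝ) < Fintype.card G := by exact_mod_cast Fintype.card_pos
  have hδ0 : 0 < δ := by positivity
  have hδ2 : 1 / (2 * Fintype.card G : ℝ) = 2 * δ := by rw [hδ]; field_simp
  obtain ⟨e, he0, hbig, hcross⟩ := hα.exists_nearly_orthogonal hm hm0 hm2 (mul_pos hμ hδ0)
  rw [hδ2] at hbig
  have hes : star e = e := (IsSelfAdjoint.of_nonneg he0).star_eq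
  set p := e * m * e with hp
  have hp0 : 0 ≤ p := by
    have := star_left_conjugate_nonneg hm0 e
    rwa [hes] at this
  have hps := IsSelfAdjoint.of_nonneg hp0
  set l := cutdown p δ with hl
  have hls : star l = l := (cfcₙ_predicate (fun t : ℝ => max (t - δ) 0) p : IsSelfAdjoint _).star_eq
  have hf0 : (fun t : ℝ => max (t - δ) 0) 0 = 0 := by simpa using hδ0.le
  have hll : l * l = cfcₙ (fun t : ℝ => max (t - δ) 0 * max (t - δ) 0) p := by
    rw [cfcₙ_mul (fun t : ℝ => max (t - δ) 0) (fun t : ℝ => max (t - δ) 0) p (by fun_prop) hf0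
      (by fun_prop) hf0]; rfl
  have hlpl : l * p * l = cfcₙ (fun t : ℝ => max (t - δ) 0 * t * max (t - δ) 0) p := by
    rw [cfcₙ_mul (fun t : ℝ => max (t - δ) 0 * t) (fun t : ℝ => max (t - δ) 0) p (by fun_prop)
      (by rw [mul_zero]) (by fun_prop) hf0, cfcₙ_mul (fun t : ℝ => max (t - δ) 0) (fun t : ℝ => t) p
      (by fun_prop) hf0 (by fun_prop) rfl, cfcₙ_id' ℝ p]; rfl
  have hu : star (e * l) * m * (e * l) = l * p * l := by
    rw [star_mul, hls, hes, hp]; simp only [mul_assoc]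
  have hle : δ • (l * l) ≤ l * p * l := by
    rw [hll, hlpl, ← cfcₙ_smul δ _ p (by fun_prop) (by simpa using hδ0.le)]
    refine cfcₙ_mono (hf0 := by simp [hδ0.le]) (hg0 := by rw [mul_zero, zero_mul])
      fun t ht => ?_
    rw [smul_eq_mul]
    rcases le_total t δ with h | h
    · rw [max_eq_right (by linarith)]; simp
    · rw [max_eq_left (by linarith)]; nlinarith [mul_nonneg (sub_nonneg.2 h) (sub_nonneg.2 h)]
  refine ⟨e * l, ?_, fun z g hg => ?_⟩
  · rw [hu]
    intro h
    rw [h] at hle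
    have h0 : l * l = 0 := by
      have h1 : 0 ≤ l * l := by nth_rw 1 [← hls]; exact star_mul_self_nonneg l
      have h2 : l * l ≤ 0 := by
        have := smul_le_smul_of_nonneg_left hle (inv_nonneg.2 hδ0.le)
        rwa [smul_smul, inv_mul_cancel₀ hδ0.ne', one_smul, smul_zero] at this
      exact le_antisymm h2 h1
    have hl0 : l = 0 := by
      nth_rw 1 [← hls] at h0
      exact CStarRing.star_mul_self_eq_zero_iff _ |>.1 h0
    have := norm_cutdown_sub_le hp0 hδ0.le
    rw [← hl, hl0, zero_sub, norm_neg] at this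
    linarith
  · rw [hu]
    have h1 : z * star (e * l) * m * α g (e * l * star z) =
        (z * l) * (e * m * α g e) * α g (star (z * l)) := by
      simp only [star_mul, hls, hes, map_mul, mul_assoc]
    have h2 : ‖α g (star (z * l))‖ ≤ ‖z * l‖ := by
      refine (NonUnitalStarAlgHom.norm_apply_le (α g) _).trans ?_
      rw [norm_star]
    have h3 : δ * (‖z * l‖ * ‖z * l‖) ≤ ‖z * (l * p * l) * star z‖ := by
      have h4 : z * (δ • (l * l)) * star z ≤ z * (l * p * l) * star z :=
        star_right_conjugate_le_conjugate hle z
      have h5 : z * (δ • (l * l)) * star z = δ • ((z * l) * star (z * l)) := by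
        simp only [star_mul, hls, mul_smul_comm, smul_mul_assoc, mul_assoc]
      rw [h5] at h4
      have h6 := CStarAlgebra.norm_le_norm_of_nonneg_of_le
        (smul_nonneg hδ0.le (mul_star_self_nonneg (z * l))) h4
      rwa [norm_smul, Real.norm_of_nonneg hδ0.le, CStarRing.norm_self_mul_star] at h6
    rw [h1]
    refine (norm_mul₃_le).trans ?_
    have h7 := hcross g hg
    calc ‖z * l‖ * ‖e * m * α g e‖ * ‖α g (star (z * l))‖
        ≤ ‖z * l‖ * (μ * δ) * ‖z * l‖ := by gcongr
      _ = μ * (δ * (‖z * l‖ * ‖z * l‖)) := by ring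
      _ ≤ _ := by gcongr

theorem exists_rapidly_decreasing_seq {S : Set ℝ} (hS : AccPt (0 : ℝ) (𝓟 S)) {δ : ℝ}
    (hδ : 0 < δ) :
    ∃ t : ℕ → ℝ, (∀ i, t i ∈ S) ∧ (∀ i, t i ≠ 0) ∧ (∀ i, |t i| < δ) ∧
      ∀ i j, i < j → |t j| < |t i| / 4 := by
  have h : ∀ r : {r : ℝ // 0 < r}, ∃ t ∈ S, t ≠ 0 ∧ |t| < r := by
    rintro ⟨r, hr⟩
    obtain ⟨t, ⟨ht, htS⟩, ht0⟩ := accPt_iff_nhds.1 hS _ (Metric.ball_mem_nhds 0 hr)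
    exact ⟨t, htS, ht0, by simpa using ht⟩
  choose f hfS hf0 hfr using h
  let r : ℕ → {r : ℝ // 0 < r} := fun i =>
    Nat.rec ⟨δ, hδ⟩ (fun _ r => ⟨|f r| / 4, by have := abs_pos.2 (hf0 r); positivity⟩) i
  have hr (i : ℕ) : (r (i + 1) : ℝ) = |f (r i)| / 4 := rfl
  have hanti : Antitone fun i : ℕ => (r i).1 := antitone_nat_of_succ_le fun i => by
    change (r (i + 1)).1 ≤ (r i).1
    rw [hr]
    linarith [hfr (r i), (r i).2]
  refine ⟨fun i => f (r i), fun i => hfS _, fun i => hf0 _, fun i => ?_, fun i j hij => ?_⟩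
  · exact (hfr _).trans_le (hanti (Nat.zero_le i))
  · exact (hfr _).trans_le ((hanti (Nat.succ_le_of_lt hij)).trans (hr i).le)

theorem cfcₙ_mul_self_mul {B : Type*} [NonUnitalCStarAlgebra B] {b : B} (hb : IsSelfAdjoint b)
    {f g : ℝ → ℝ} (hf : Continuous f) (hf0 : f 0 = 0) (hg : Continuous g) (hg0 : g 0 = 0) :
    cfcₙ f b * b * cfcₙ g b = cfcₙ (fun t => f t * t * g t) b := by
  rw [cfcₙ_mul (fun t => f t * t) g b (by fun_prop) (by rw [mul_zero]) (by fun_prop) hg0,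
    cfcₙ_mul f (fun t => t) b (by fun_prop) hf0 (by fun_prop) rfl, cfcₙ_id' ℝ b]

/-- If `0` is an accumulation point of the spectrum of `b`, there are functions `χ` and
`k i`, acting on disjoint parts of the spectrum, such that `χ` nearly preserves `b` and
`k i` does not annihilate `b`. -/
theorem exists_spectral_bumps {B : Type*} [NonUnitalCStarAlgebra B] {b : B}
    (hb : IsSelfAdjoint b) (hsp : AccPt (0 : ℝ) (𝓟 (quasispectrum ℝ b))) (n : ℕ) {ε : ℝ}
    (hε : 0 < ε) :
    ∃ (χ : ℝ → ℝ) (k : Fin n → ℝ → ℝ), (Continuous χ ∧ χ 0 = 0) ∧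
      (∀ i, Continuous (k i) ∧ k i 0 = 0) ∧
      ‖cfcₙ χ b * b * cfcₙ χ b - b‖ ≤ ε ∧
      (∀ i j, i ≠ j → cfcₙ (k i) b * b * cfcₙ (k j) b = 0) ∧
      (∀ i, cfcₙ χ b * b * cfcₙ (k i) b = 0) ∧
      (∀ i, cfcₙ (k i) b * b * cfcₙ (k i) b ≠ 0) := by
  set δ := ε / 2 with hδ
  have hδ0 : 0 < δ := by positivity
  obtain ⟨t, htS, ht0, htδ, htt⟩ := exists_rapidly_decreasing_seq hsp (half_pos hδ0)
  have htp (i : ℕ) : 0 < |t i| := abs_pos.2 (ht0 i)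
  set χ : ℝ → ℝ := fun s => min 1 (max (|s| / δ - 1) 0) with hχ
  set k : ℕ → ℝ → ℝ := fun i s => max 0 (1 - |s - t i| / (|t i| / 2)) with hk
  have hχc : Continuous χ := by fun_prop
  have hkc (i : ℕ) : Continuous (k i) := by fun_prop
  have hχ0 : χ 0 = 0 := by simp [hχ]
  have hk_out (i : ℕ) (s : ℝ) (hs : |t i| / 2 ≤ |s - t i|) : k i s = 0 := by
    have := htp i
    simp only [hk]
    rw [max_eq_left]
    rw [sub_nonpos, le_div_iff₀ (by positivity)]
    linarith
  have hk0 (i : ℕ) : k i 0 = 0 := hk_out i 0 (by rw [zero_sub, abs_neg]; linarith [htp i])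
  have hk_small (i : ℕ) (s : ℝ) (hs : |s| ≤ |t i| / 2) : k i s = 0 := by
    refine hk_out i s ?_
    rw [abs_sub_comm]
    linarith [abs_sub_abs_le_abs_sub (t i) s]
  have hk_large (i : ℕ) (s : ℝ) (hs : 2 * |t i| ≤ |s|) : k i s = 0 := by
    refine hk_out i s ?_
    linarith [abs_sub_abs_le_abs_sub s (t i), htp i]
  have hkk (i j : ℕ) (hij : i < j) (s : ℝ) : k i s = 0 ∨ k j s = 0 := by
    rcases le_total |s| (|t i| / 2) with h | h
    · exact Or.inl (hk_small i s h)
    · exact Or.inr (hk_large j s (by linarith [htt i j hij]))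
  refine ⟨χ, fun i => k i, ⟨hχc, hχ0⟩, fun i => ⟨hkc i, hk0 i⟩, ?_, fun i j hij => ?_,
    fun i => ?_, fun i => ?_⟩
  · rw [cfcₙ_mul_self_mul hb hχc hχ0 hχc hχ0]
    nth_rw 2 [← cfcₙ_id' ℝ b]
    rw [← cfcₙ_sub (fun s => χ s * s * χ s) (fun s => s) b (by fun_prop) (by rw [mul_zero, zero_mul])
      (by fun_prop) rfl]
    refine norm_cfcₙ_le fun s _ => ?_
    have h0 : 0 ≤ χ s := le_min zero_le_one (le_max_right _ _)
    have h1 : χ s ≤ 1 := min_le_left _ _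
    rcases le_total |s| ε with h | h
    · have e : χ s * s * χ s - s = s * (χ s * χ s - 1) := by ring
      rw [e, norm_mul, Real.norm_eq_abs, Real.norm_eq_abs]
      have : |χ s * χ s - 1| ≤ 1 := by rw [abs_le]; constructor <;> nlinarith
      nlinarith [abs_nonneg s]
    · have : χ s = 1 := by
        refine min_eq_left (le_max_of_le_left ?_)
        rw [le_sub_iff_add_le, le_div_iff₀ hδ0]
        linarith
      rw [this]
      simpa using hε.le
  · rw [cfcₙ_mul_self_mul hb (hkc i) (hk0 i) (hkc j) (hk0 j)]
    convert cfcₙ_zero ℝ b using 2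
    funext s
    have : k i s = 0 ∨ k j s = 0 := by
      rcases lt_or_gt_of_ne (fun h => hij (Fin.ext h) : (i : ℕ) ≠ j) with h | h
      · exact hkk i j h s
      · exact (hkk j i h s).symm
    rcases this with h | h <;> simp [h]
  · rw [cfcₙ_mul_self_mul hb hχc hχ0 (hkc i) (hk0 i)]
    convert cfcₙ_zero ℝ b using 2
    funext s
    rcases le_total |s| δ with h | h
    · have : χ s = 0 := by
        simp only [hχ]
        rw [max_eq_right, min_eq_right zero_le_one]
        rw [sub_nonpos, div_le_iff₀ hδ0]
        linarith
      simp [this]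
    · simp [hk_large i s (by linarith [htδ i])]
  · rw [cfcₙ_mul_self_mul hb (hkc i) (hk0 i) (hkc i) (hk0 i)]
    intro h
    have h1 := norm_apply_le_norm_cfcₙ (fun s => k i s * s * k i s) b (htS i)
      (by fun_prop) (by simp [hk0])
    rw [h, norm_zero] at h1
    have h2 : k i (t i) = 1 := by simp [hk]
    simp only [h2, one_mul, mul_one] at h1
    exact ht0 i (norm_le_zero_iff.1 h1)

section averaging

variable {G : Type*} [Group G] [Fintype G] {B : Type*} [NonUnitalCStarAlgebra B]

theorem tendsto_mul_zero_of_norm_le {ι : Type*} {l : Filter ι} {c x : ι → B} {C : ℝ}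
    (hc : ∀ k, ‖c k‖ ≤ C) (hx : Tendsto x l (𝓝 0)) :
    Tendsto (fun k => c k * x k) l (𝓝 0) := by
  refine squeeze_zero_norm (fun k => (norm_mul_le _ _).trans
    (mul_le_mul_of_nonneg_right (hc k) (norm_nonneg _))) ?_
  simpa using hx.norm.const_mul C

theorem tendsto_zero_mul_of_norm_le {ι : Type*} {l : Filter ι} {c x : ι → B} {C : ℝ}
    (hc : ∀ k, ‖c k‖ ≤ C) (hx : Tendsto x l (𝓝 0)) :
    Tendsto (fun k => x k * c k) l (𝓝 0) := by
  refine squeeze_zero_norm (fun k => (norm_mul_le _ _).trans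
    (mul_le_mul_of_nonneg_left (hc k) (norm_nonneg _))) ?_
  simpa using hx.norm.mul_const C

theorem tendsto_sum_zero {κ ι : Type*} [Fintype κ] {l : Filter ι} {f : κ → ι → B}
    (hf : ∀ i, Tendsto (f i) l (𝓝 0)) : Tendsto (fun k => ∑ i, f i k) l (𝓝 0) := by
  simpa using tendsto_finsetSum Finset.univ fun i _ => hf i

theorem map_real_smul_starAlgHom (φ : B →⋆ₙₐ[ℂ] B) (r : ℝ) (x : B) : φ (r • x) = r • φ x := by
  rw [← Complex.coe_smul, map_smul, Complex.coe_smul]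

theorem tendsto_sum_sandwich_sub {κ : Type*} [Fintype κ] {H : ℕ → κ → B} (hH1 : ∀ k g, ‖H k g‖ ≤ 1)
    (horth : ∀ k g h, g ≠ h → H k g * H k h = 0) {T : κ → κ → B}
    (hT : ∀ g h, Tendsto (fun k => T g h * H k g - H k g * T g h) atTop (𝓝 0)) :
    Tendsto (fun k => ∑ g, ∑ h, H k g * T g h * H k h - ∑ g, H k g * T g g * H k g) atTop
      (𝓝 0) := by
  classical
  have e (k : ℕ) : ∑ g, ∑ h, H k g * T g h * H k h - ∑ g, H k g * T g g * H k g =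
      ∑ g, ∑ h, if g = h then 0 else -((T g h * H k g - H k g * T g h) * H k h) := by
    rw [← Finset.sum_sub_distrib]
    refine Finset.sum_congr rfl fun g _ => ?_
    have : H k g * T g g * H k g = ∑ h, if g = h then H k g * T g h * H k h else 0 := by
      rw [Finset.sum_ite_eq, if_pos (Finset.mem_univ g)]
    rw [this, ← Finset.sum_sub_distrib]
    refine Finset.sum_congr rfl fun h _ => ?_
    split_ifs with hgh
    · rw [sub_self]
    · rw [sub_zero, sub_mul, mul_assoc (T g h), horth k g h hgh]
      simp
  simp only [e]
  refine tendsto_sum_zero fun g => ?_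
  refine tendsto_sum_zero fun h => ?_
  split_ifs
  · exact tendsto_const_nhds
  · have := tendsto_zero_mul_of_norm_le (fun k => hH1 k h) (hT g h)
    simpa using this.neg

theorem tendsto_map_sum_sub {β : G → B →⋆ₙₐ[ℂ] B} (hβ : ∀ g h x, β (g * h) x = β g (β h x))
    {H : ℕ → G → B} (htr : ∀ g h, Tendsto (fun k => β g (H k h) - H k (g * h)) atTop (𝓝 0))
    (w : B) (g : G) :
    Tendsto (fun k => β g (∑ h, H k h * β h w) - ∑ h, H k h * β h w) atTop (𝓝 0) := by
  have e (k : ℕ) : β g (∑ h, H k h * β h w) - ∑ h, H k h * β h w =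
      ∑ h, (β g (H k h) - H k (g * h)) * β (g * h) w := by
    rw [map_sum, ← Equiv.sum_comp (Equiv.mulLeft g) fun h => H k h * β h w,
      ← Finset.sum_sub_distrib]
    refine Finset.sum_congr rfl fun h _ => ?_
    simp [hβ, sub_mul]
  simp only [e]
  exact tendsto_sum_zero fun h => tendsto_zero_mul_of_norm_le (fun _ => le_rfl) (htr g h)

theorem tendsto_map_conjugate_sum_sub {β : G → B →⋆ₙₐ[ℂ] B} {H : ℕ → G → B}
    (hHs : ∀ k g, IsSelfAdjoint (H k g)) (hH1 : ∀ k g, ‖H k g‖ ≤ 1)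
    (htr : ∀ g h, Tendsto (fun k => β g (H k h) - H k (g * h)) atTop (𝓝 0)) (v : B) (g : G)
    (hv : ∀ h, Tendsto (fun k => β g v * H k h - H k h * β g v) atTop (𝓝 0)) :
    Tendsto (fun k => β g (star v * (∑ h, H k h * H k h) * v) -
      ∑ h, H k h * β g (star v * v) * H k h) atTop (𝓝 0) := by
  set p := β g v with hp
  have e (k : ℕ) : β g (star v * (∑ h, H k h * H k h) * v) -
      ∑ h, H k h * β g (star v * v) * H k h =
      ∑ h, (star p * ((β g (H k h) - H k (g * h)) * β g (H k h) +
        H k (g * h) * (β g (H k h) - H k (g * h))) * p +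
        (-star (p * H k (g * h) - H k (g * h) * p) * (H k (g * h) * p) -
          H k (g * h) * star p * (p * H k (g * h) - H k (g * h) * p))) := by
    rw [← Equiv.sum_comp (Equiv.mulLeft g) fun h => H k h * β g (star v * v) * H k h,
      Finset.mul_sum, Finset.sum_mul, map_sum, ← Finset.sum_sub_distrib]
    refine Finset.sum_congr rfl fun h _ => ?_
    simp only [Equiv.coe_mulLeft, map_mul, map_star, ← hp, star_sub, star_mul,
      (hHs k (g * h)).star_eq, sub_mul, mul_sub, mul_add, add_mul, mul_assoc, neg_mul]
    abel
  have hβ1 (k : ℕ) (h : G) : ‖β g (H k h)‖ ≤ 1 :=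
    (NonUnitalStarAlgHom.norm_apply_le (β g) _).trans (hH1 k h)
  simp only [e]
  refine tendsto_sum_zero fun h => ?_
  have hd := htr g h
  have hc := hv (g * h)
  have h1 : Tendsto (fun k => (β g (H k h) - H k (g * h)) * β g (H k h) +
      H k (g * h) * (β g (H k h) - H k (g * h))) atTop (𝓝 0) := by
    simpa using (tendsto_zero_mul_of_norm_le (fun k => hβ1 k h) hd).add
      (tendsto_mul_zero_of_norm_le (fun k => hH1 k (g * h)) hd)
  have h2 : Tendsto (fun k => star p * ((β g (H k h) - H k (g * h)) * β g (H k h) +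
      H k (g * h) * (β g (H k h) - H k (g * h))) * p) atTop (𝓝 0) := by
    simpa using (h1.const_mul (star p)).mul_const p
  have hb (k : ℕ) (q : B) : ‖H k (g * h) * q‖ ≤ ‖q‖ :=
    (norm_mul_le _ _).trans (mul_le_of_le_one_left (norm_nonneg _) (hH1 _ _))
  have h3 : Tendsto (fun k => -star (p * H k (g * h) - H k (g * h) * p) *
      (H k (g * h) * p)) atTop (𝓝 0) := by
    exact tendsto_zero_mul_of_norm_le (fun k => hb k p) (by simpa using hc.star.neg)
  have h4 : Tendsto (fun k => H k (g * h) * star p * (p * H k (g * h) - H k (g * h) * p)) atTop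
      (𝓝 0) := tendsto_mul_zero_of_norm_le (fun k => hb k (star p)) hc
  simpa using h2.add (h3.sub h4)

theorem norm_sum_mul_star_sub_le {β : G → B →⋆ₙₐ[ℂ] B} (hβ : ∀ g h x, β (g * h) x = β g (β h x))
    {b R : B} (hb : ∀ g, β g b = b) {ε : ℝ} (hε : 0 ≤ ε)
    (hR : ∀ g, g ≠ 1 → ‖R * b * star (β g R)‖ ≤ ε) :
    ‖(∑ g, β g R) * b * star (∑ g, β g R) - ∑ g, β g R * b * star (β g R)‖ ≤
      Fintype.card G * (Fintype.card G * ε) := by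
  classical
  have e : (∑ g, β g R) * b * star (∑ g, β g R) - ∑ g, β g R * b * star (β g R) =
      ∑ g, ∑ h, if g = h then 0 else β g R * b * star (β h R) := by
    rw [star_sum, Finset.sum_mul, Finset.sum_mul_sum, ← Finset.sum_sub_distrib]
    refine Finset.sum_congr rfl fun g _ => ?_
    have : β g R * b * star (β g R) = ∑ h, if g = h then β g R * b * star (β h R) else 0 := by
      rw [Finset.sum_ite_eq, if_pos (Finset.mem_univ g)]
    rw [this, ← Finset.sum_sub_distrib]
    refine Finset.sum_congr rfl fun h _ => ?_
    split_ifs <;> simp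
  rw [e]
  refine (norm_sum_le _ _).trans ((Finset.sum_le_card_nsmul _ _ _ fun g _ =>
    (norm_sum_le _ _).trans (Finset.sum_le_card_nsmul _ _ ε fun h _ => ?_)).trans_eq ?_)
  · split_ifs with hgh
    · simpa using hε
    · have h1 : β g R * b * star (β h R) = β g (R * b * star (β (g⁻¹ * h) R)) := by
        rw [map_mul, map_mul, map_star, hb, ← hβ, mul_inv_cancel_left]
      rw [h1]
      exact (NonUnitalStarAlgHom.norm_apply_le (β g) _).trans
        (hR _ fun h2 => hgh (inv_mul_eq_one.1 h2))
  · simp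

/-- Approximate equivariance of the `H k` allows one to replace approximate implementers of a
Cuntz subequivalence by fixed ones. -/
theorem exists_fixed_conjugate {β : G → B →⋆ₙₐ[ℂ] B} (hβ : ∀ g h x, β (g * h) x = β g (β h x))
    {a b w v : B} (ha : ∀ g, β g a = a) (hb : ∀ g, β g b = b) (hbs : IsSelfAdjoint b)
    {ε : ℝ} (hε : 0 < ε) (hw : ‖w * b * star w - a‖ ≤ ε) (hv : ‖star v * v - a‖ ≤ ε)
    {H : ℕ → G → B} (hHs : ∀ k g, IsSelfAdjoint (H k g)) (hH1 : ∀ k g, ‖H k g‖ ≤ 1)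
    (horth : ∀ k g h, g ≠ h → H k g * H k h = 0)
    (htr : ∀ g h, Tendsto (fun k => β g (H k h) - H k (g * h)) atTop (𝓝 0))
    (hHw : ∀ g h, Tendsto (fun k => β g w * b * star (β h w) * H k g -
      H k g * (β g w * b * star (β h w))) atTop (𝓝 0))
    (hHv : ∀ g h, Tendsto (fun k => β g v * H k h - H k h * β g v) atTop (𝓝 0))
    {R : ℕ → B}
    (hR : Tendsto (fun k => R k * b * star (R k) -
      (star v * v - star v * (∑ h, H k h * H k h) * v)) atTop (𝓝 0))
    (hRR : ∀ᶠ k in atTop, ∀ g, g ≠ 1 → ‖R k * b * star (β g (R k))‖ ≤ ε)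
    (hwR : ∀ k g h, β g w * b * star (β h (R k)) = 0) :
    ∃ V : B, (∀ g, β g V = V) ∧ ‖V * b * star V - a‖ ≤ (3 * Fintype.card G + 2) * ε := by
  set N : ℝ := ((Fintype.card G : ℕ) : ℝ) with hN
  have hN0 : 0 < N := by rw [hN]; exact_mod_cast Fintype.card_pos
  set X : ℕ → B := fun k => ∑ h, H k h * β h w with hX
  set M : ℕ → B := fun k => N⁻¹ • ∑ g, β g (X k) with hM
  set S : ℕ → B := fun k => ∑ g, β g (R k) with hS
  set a₁ : B := N⁻¹ • ∑ g, β g (star v * v) with ha₁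
  have havg (x : B) : N⁻¹ • ∑ _g : G, x = x := by
    rw [Finset.sum_const, Finset.card_univ, ← Nat.cast_smul_eq_nsmul ℝ, smul_smul, ← hN,
      inv_mul_cancel₀ hN0.ne', one_smul]
  have havg_le (x : G → B) (C : ℝ) (hx : ∀ g, ‖x g‖ ≤ C) : ‖N⁻¹ • ∑ g, x g‖ ≤ C := by
    rw [norm_smul, norm_inv, Real.norm_of_nonneg hN0.le, inv_mul_le_iff₀ hN0]
    refine (norm_sum_le _ _).trans ((Finset.sum_le_card_nsmul _ _ C fun g _ => hx g).trans_eq ?_)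
    rw [Finset.card_univ, nsmul_eq_mul]
  have hβn (g : G) (x : B) : ‖β g x‖ ≤ ‖x‖ := NonUnitalStarAlgHom.norm_apply_le (β g) x
  have hsum_fixed (g : G) (x : B) : β g (∑ h, β h x) = ∑ h, β h x := by
    rw [map_sum, ← Equiv.sum_comp (Equiv.mulLeft g) fun h => β h x]
    simp [hβ]
  have hMX : Tendsto (fun k => M k - X k) atTop (𝓝 0) := by
    have e (k : ℕ) : M k - X k = N⁻¹ • ∑ g, (β g (X k) - X k) := by
      rw [Finset.sum_sub_distrib, smul_sub, havg]
    simp only [e]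
    have := (tendsto_sum_zero fun g => tendsto_map_sum_sub hβ htr w g).const_smul N⁻¹
    rwa [smul_zero] at this
  have hXn (k : ℕ) : ‖X k‖ ≤ N * ‖w‖ := by
    refine (norm_sum_le _ _).trans ((Finset.sum_le_card_nsmul _ _ ‖w‖ fun g _ => ?_).trans_eq ?_)
    · exact (norm_mul_le _ _).trans ((mul_le_of_le_one_left (norm_nonneg _) (hH1 k g)).trans
        (hβn g w))
    · rw [Finset.card_univ, nsmul_eq_mul]
  have hMn (k : ℕ) : ‖M k‖ ≤ N * ‖w‖ := havg_le _ _ fun g => (hβn g _).trans (hXn k)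
  have hMbM : Tendsto (fun k => M k * b * star (M k) - X k * b * star (X k)) atTop (𝓝 0) := by
    have e (k : ℕ) : M k * b * star (M k) - X k * b * star (X k) =
        (M k - X k) * (b * star (M k)) + X k * b * star (M k - X k) := by
      simp only [star_sub, sub_mul, mul_sub, mul_assoc]; abel
    simp only [e]
    have h1 : ∀ k, ‖b * star (M k)‖ ≤ ‖b‖ * (N * ‖w‖) := fun k =>
      (norm_mul_le _ _).trans (by rw [norm_star]; gcongr; exact hMn k)
    have h2 : ∀ k, ‖X k * b‖ ≤ N * ‖w‖ * ‖b‖ := fun k =>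
      (norm_mul_le _ _).trans (by gcongr; exact hXn k)
    simpa using (tendsto_zero_mul_of_norm_le h1 hMX).add
      (tendsto_mul_zero_of_norm_le h2 (by simpa using hMX.star))
  have hXbX : Tendsto (fun k => X k * b * star (X k) -
      ∑ g, H k g * β g (w * b * star w) * H k g) atTop (𝓝 0) := by
    refine (tendsto_sum_sandwich_sub hH1 horth hHw).congr fun k => ?_
    congr 1
    · simp only [hX, star_sum, Finset.sum_mul, Finset.mul_sum]
      rw [Finset.sum_comm]
      refine Finset.sum_congr rfl fun g _ => Finset.sum_congr rfl fun h _ => ?_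
      simp only [star_mul, (hHs k _).star_eq, mul_assoc]
    · simp only [map_mul, map_star, hb]
  have hRbR : Tendsto (fun k => N⁻¹ • ∑ g, β g (R k) * b * star (β g (R k)) -
      (a₁ - ∑ h, H k h * a₁ * H k h)) atTop (𝓝 0) := by
    have e (k : ℕ) : N⁻¹ • ∑ g, β g (R k) * b * star (β g (R k)) -
        (a₁ - ∑ h, H k h * a₁ * H k h) =
        N⁻¹ • ∑ g, (β g (R k * b * star (R k) -
          (star v * v - star v * (∑ h, H k h * H k h) * v)) -
          (β g (star v * (∑ h, H k h * H k h) * v) -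
            ∑ h, H k h * β g (star v * v) * H k h)) := by
      have h1 : ∑ h, H k h * a₁ * H k h =
          N⁻¹ • ∑ g, ∑ h, H k h * β g (star v * v) * H k h := by
        rw [Finset.sum_comm, Finset.smul_sum]
        refine Finset.sum_congr rfl fun h _ => ?_
        rw [ha₁, mul_smul_comm, smul_mul_assoc, Finset.mul_sum, Finset.sum_mul]
      rw [h1, ha₁, ← smul_sub, ← smul_sub, ← Finset.sum_sub_distrib, ← Finset.sum_sub_distrib]
      congr 1
      refine Finset.sum_congr rfl fun g _ => ?_
      rw [map_sub (β g), map_sub (β g), map_mul (β g) (R k * b), map_mul (β g) (R k), hb, map_star]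
      abel
    simp only [e]
    have h1 (g : G) : Tendsto (fun k => β g (R k * b * star (R k) -
        (star v * v - star v * (∑ h, H k h * H k h) * v))) atTop (𝓝 0) :=
      squeeze_zero_norm (fun k => hβn g _) (by simpa using hR.norm)
    have h2 (g : G) := (h1 g).sub (tendsto_map_conjugate_sum_sub hHs hH1 htr v g (hHv g))
    simp only [sub_zero] at h2
    have h3 := (tendsto_sum_zero h2).const_smul N⁻¹
    rwa [smul_zero] at h3
  have hsmall : ∀ᶠ k in atTop, ‖(M k * b * star (M k) - X k * b * star (X k)) +
      (X k * b * star (X k) - ∑ g, H k g * β g (w * b * star w) * H k g) +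
      (N⁻¹ • ∑ g, β g (R k) * b * star (β g (R k)) -
        (a₁ - ∑ h, H k h * a₁ * H k h))‖ < ε := by
    have := ((hMbM.add hXbX).add hRbR).norm
    simp only [add_zero, norm_zero] at this
    exact this.eventually (gt_mem_nhds hε)
  obtain ⟨k, hk1, hk2⟩ := (hsmall.and hRR).exists
  have hMS : M k * b * star (S k) = 0 := by
    have h1 (g h : G) : β g (X k) * b * star (β h (R k)) = 0 := by
      simp only [hX, map_sum, map_mul, Finset.sum_mul, ← hβ, mul_assoc]
      refine Finset.sum_eq_zero fun i _ => ?_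
      rw [← mul_assoc (β (g * i) w), hwR, mul_zero]
    simp only [hM, hS, star_sum, smul_mul_assoc, Finset.sum_mul, Finset.mul_sum, h1,
      Finset.sum_const_zero, smul_zero]
  have hSM : S k * b * star (M k) = 0 := by
    have := congrArg star hMS
    rwa [star_mul, star_mul, star_star, hbs.star_eq, star_zero, ← mul_assoc] at this
  set c : ℝ := √N⁻¹ with hc
  have hcc : c * c = N⁻¹ := Real.mul_self_sqrt (by positivity)
  refine ⟨M k + c • S k, fun g => ?_, ?_⟩
  · rw [map_add, hM, hS, map_real_smul_starAlgHom, map_real_smul_starAlgHom, hsum_fixed, hsum_fixed]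
  have hVbV : (M k + c • S k) * b * star (M k + c • S k) =
      M k * b * star (M k) + N⁻¹ • (S k * b * star (S k)) := by
    rw [← hcc]
    simp only [star_add, star_smul, star_trivial, add_mul, mul_add, smul_mul_assoc, mul_smul_comm,
      hMS, hSM, smul_zero, zero_add, add_zero, smul_smul]
  have hβa (g : G) (x : B) : ‖β g x - a‖ ≤ ‖x - a‖ := by
    have := hβn g (x - a)
    rwa [map_sub, ha] at this
  have hd2 : ‖a₁ - a‖ ≤ ε := by
    rw [← havg a, ha₁, ← smul_sub, ← Finset.sum_sub_distrib]
    exact havg_le _ _ fun g => (hβa g _).trans hv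
  have hd1 : ‖∑ h, H k h * (β h (w * b * star w) - a₁) * H k h‖ ≤ N * (2 * ε) := by
    refine (norm_sum_le _ _).trans ((Finset.sum_le_card_nsmul _ _ (2 * ε) fun h _ => ?_).trans_eq ?_)
    · have h2 : ‖β h (w * b * star w) - a₁‖ ≤ 2 * ε := by
        have h3 := (hβa h _).trans hw
        have h4 := norm_sub_le (β h (w * b * star w) - a) (a₁ - a)
        rw [sub_sub_sub_cancel_right] at h4
        linarith
      refine norm_mul₃_le.trans ?_
      calc _ ≤ 1 * (2 * ε) * 1 := by gcongr <;> exact hH1 k h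
        _ = _ := by ring
    · rw [Finset.card_univ, nsmul_eq_mul]
  have hd3 : ‖N⁻¹ • (S k * b * star (S k) - ∑ g, β g (R k) * b * star (β g (R k)))‖ ≤ N * ε := by
    rw [norm_smul, norm_inv, Real.norm_of_nonneg hN0.le, inv_mul_le_iff₀ hN0]
    exact norm_sum_mul_star_sub_le hβ hb hε.le hk2
  have e : (M k + c • S k) * b * star (M k + c • S k) - a =
      ((M k * b * star (M k) - X k * b * star (X k)) +
        (X k * b * star (X k) - ∑ g, H k g * β g (w * b * star w) * H k g) +
        (N⁻¹ • ∑ g, β g (R k) * b * star (β g (R k)) -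
          (a₁ - ∑ h, H k h * a₁ * H k h))) +
      (∑ h, H k h * (β h (w * b * star w) - a₁) * H k h) + (a₁ - a) +
      N⁻¹ • (S k * b * star (S k) - ∑ g, β g (R k) * b * star (β g (R k))) := by
    rw [hVbV]
    simp only [mul_sub, sub_mul, Finset.sum_sub_distrib, smul_sub]
    abel
  rw [e]
  refine (norm_add₄_le).trans ?_
  linarith

end averaging

section matrix

/-- The diagonal embedding of a power of `B` into matrices over `B`. -/
def CStarMatrix.diagonalStarHom (ι : Type*) [Fintype ι] [DecidableEq ι] (B : Type*)
    [NonUnitalCStarAlgebra B] : (ι → B) →⋆ₙₐ[ℂ] CStarMatrix ι ι B where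
  toFun c := ofMatrix (Matrix.diagonal c)
  map_smul' r c := by
    ext i j
    change Matrix.diagonal (r • c) i j = r • Matrix.diagonal c i j
    rw [Matrix.diagonal_smul]; rfl
  map_zero' := by
    ext i j
    exact congrFun (congrFun (Matrix.diagonal_zero (n := ι) (α := B)) i) j
  map_add' c d := by
    ext i j
    exact congrFun (congrFun (Matrix.diagonal_add c d).symm i) j
  map_mul' c d := by
    ext i j
    exact congrFun (congrFun (Matrix.diagonal_mul_diagonal c d).symm i) j
  map_star' c := by
    ext i j
    exact congrFun (congrFun (Matrix.diagonal_conjTranspose c).symm i) j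

variable {ι : Type*} [DecidableEq ι]

/-- The matrix with a single, possibly nonzero, entry. -/
def CStarMatrix.single {B : Type*} [NonUnitalCStarAlgebra B] (i j : ι) (x : B) :
    CStarMatrix ι ι B :=
  ofMatrix (Matrix.single i j x)

theorem CStarMatrix.star_single {B : Type*} [NonUnitalCStarAlgebra B] (i j : ι) (x : B) :
    star (single i j x) = single j i (star x) :=
  Matrix.conjTranspose_single i j x

variable [Fintype ι]

theorem CStarMatrix.diagonalStarHom_mul_apply {B : Type*} [NonUnitalCStarAlgebra B] (c : ι → B)
    (M : CStarMatrix ι ι B) (i j : ι) : (diagonalStarHom ι B c * M) i j = c i * M i j :=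
  Matrix.diagonal_mul c M i j

theorem CStarMatrix.mul_diagonalStarHom_apply {B : Type*} [NonUnitalCStarAlgebra B] (c : ι → B)
    (M : CStarMatrix ι ι B) (i j : ι) : (M * diagonalStarHom ι B c) i j = M i j * c j :=
  Matrix.mul_diagonal c M i j

theorem CStarMatrix.mapₙₐ_diagonalStarHom {B : Type*} [NonUnitalCStarAlgebra B] (φ : B →⋆ₙₐ[ℂ] B)
    (c : ι → B) :
    mapₙₐ φ (diagonalStarHom ι B c) = diagonalStarHom ι B fun i => φ (c i) := by
  ext i j
  exact congrFun (congrFun (Matrix.diagonal_map (f := φ) (d := c) (map_zero φ)) i) j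

theorem CStarMatrix.mapₙₐ_single {B : Type*} [NonUnitalCStarAlgebra B] (φ : B →⋆ₙₐ[ℂ] B) (i j : ι)
    (x : B) : mapₙₐ φ (single i j x) = single i j (φ x) :=
  Matrix.map_single i j x φ

theorem CStarMatrix.single_mul_mul_single {B : Type*} [NonUnitalCStarAlgebra B] (i j k l : ι)
    (x y : B) (M : CStarMatrix ι ι B) :
    single i j x * M * single k l y = single i l (x * M j k * y) :=
  Matrix.single_mul_mul_single i j k l x M y

theorem CStarMatrix.sum_single {B : Type*} [NonUnitalCStarAlgebra B] (c : ι → B) :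
    ∑ i, single i i (c i) = diagonalStarHom ι B c := by
  have h (i : ι) : single i i (c i) = diagonalStarHom ι B (Pi.single i (c i)) :=
    (Matrix.diagonal_single i (c i)).symm
  simp only [h]
  rw [← map_sum, Finset.univ_sum_single]

end matrix

theorem IsSimpleCStarAlgebra.exists_common_conjugate_norm_eq_one (hA : IsSimpleCStarAlgebra A)
    {n : ℕ} (P : Fin n → A) (hP : ∀ i, 0 ≤ P i) (hP0 : ∀ i, P i ≠ 0) :
    ∃ x : A, 0 ≤ x ∧ ‖x‖ = 1 ∧ ∀ i, ∃ q, x = q * P i * star q := by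
  obtain ⟨x, hx, hx0, hq⟩ := hA.exists_common_conjugate P hP hP0
  have hn : ‖x‖ ≠ 0 := norm_ne_zero_iff.2 hx0
  have hn0 : 0 ≤ ‖x‖⁻¹ := by positivity
  refine ⟨‖x‖⁻¹ • x, smul_nonneg hn0 hx, ?_, fun i => ?_⟩
  · rw [norm_smul, norm_inv, norm_norm, inv_mul_cancel₀ hn]
  · obtain ⟨q, h⟩ := hq i
    refine ⟨√‖x‖⁻¹ • q, ?_⟩
    rw [star_smul, star_trivial, smul_mul_assoc, smul_mul_assoc, mul_smul_comm, smul_smul,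
      Real.mul_self_sqrt hn0, ← h]

theorem CStarMatrix.exists_diagonal_ne_zero {ι : Type*} [Fintype ι] {c : CStarMatrix ι ι A}
    (hc : star c * c ≠ 0) : ∃ j, 0 ≤ (star c * c) j j ∧ (star c * c) j j ≠ 0 := by
  have e (j : ι) : (star c * c) j j = ∑ l, star (c l j) * c l j := mul_apply
  by_contra! h
  refine hc ?_
  have hc0 : c = 0 := by
    ext l j
    have h1 := h j
    rw [e] at h1
    have h2 := (Finset.sum_eq_zero_iff_of_nonneg fun l _ => star_mul_self_nonneg (c l j)).1
      (h1 (Finset.sum_nonneg fun l _ => star_mul_self_nonneg (c l j))) l (Finset.mem_univ l)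
    exact CStarRing.star_mul_self_eq_zero_iff _ |>.1 h2
  rw [hc0, mul_zero]

theorem CStarMatrix.tendsto_zero_of_entries {B : Type*} [NonUnitalCStarAlgebra B] {ι κ : Type*}
    {l : Filter κ} {M : κ → CStarMatrix ι ι B} (h : ∀ i j, Tendsto (fun k => M k i j) l (𝓝 0)) :
    Tendsto M l (𝓝 0) :=
  tendsto_pi_nhds.2 fun i => tendsto_pi_nhds.2 fun j => h i j

theorem CStarMatrix.norm_diagonalStarHom_le {ι : Type*} [Fintype ι] [DecidableEq ι] {c : ι → A}
    {C : ℝ} (hC : 0 ≤ C) (hc : ∀ i, ‖c i‖ ≤ C) : ‖diagonalStarHom ι A c‖ ≤ C :=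
  (NonUnitalStarAlgHom.norm_apply_le (diagonalStarHom ι A) c).trans
    ((pi_norm_le_iff_of_nonneg hC).2 hc)

theorem CStarMatrix.sum_single_mul_star_sum_single {B : Type*} [NonUnitalCStarAlgebra B]
    {ι : Type*} [Fintype ι] [DecidableEq ι] {b : CStarMatrix ι ι B} {K : ι → CStarMatrix ι ι B}
    (hK : ∀ i, IsSelfAdjoint (K i)) (horth : ∀ i l, i ≠ l → K i * b * K l = 0)
    (L L' : CStarMatrix ι ι B) (j : ι → ι) (c c' : ι → B) :
    (∑ i, L * single i (j i) (c i) * K i) * b * star (∑ i, L' * single i (j i) (c' i) * K i) =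
      L * diagonalStarHom ι B (fun i => c i * (K i * b * K i) (j i) (j i) * star (c' i)) *
        star L' := by
  have hR (d : ι → B) : L * diagonalStarHom ι B d * star L' =
      ∑ i, L * single i i (d i) * star L' := by
    rw [← sum_single, Finset.mul_sum, Finset.sum_mul]
  rw [hR, star_sum, Finset.sum_mul, Finset.sum_mul_sum]
  refine Finset.sum_congr rfl fun i _ => ?_
  rw [Finset.sum_eq_single i]
  · rw [← single_mul_mul_single]
    simp only [star_mul, star_single, (hK i).star_eq, mul_assoc]
  · intro l _ hl
    have : L * single i (j i) (c i) * K i * b * star (L' * single l (j l) (c' l) * K l) =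
        L * single i (j i) (c i) * (K i * b * K l) * (single (j l) l (star (c' l)) * star L') := by
      simp only [star_mul, star_single, (hK l).star_eq, mul_assoc]
    rw [this, horth i l hl.symm]
    simp
  · simp

/-- Compressing `star v * v` by a positive contraction from an approximate unit. -/
theorem CStarMatrix.exists_diagonal_compression {ι : Type*} [Fintype ι] [DecidableEq ι]
    (v : CStarMatrix ι ι A) {ε : ℝ} (hε : 0 < ε) :
    ∃ y : A, 0 ≤ y ∧ ‖y‖ ≤ 1 ∧
      ‖star (diagonalStarHom ι A (fun _ => y) * v) * (diagonalStarHom ι A (fun _ => y) * v) -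
        star v * v‖ ≤ ε := by
  have hu := CStarAlgebra.increasingApproximateUnit A
  have := hu.neBot
  have h1 : Tendsto (fun y : A => diagonalStarHom ι A (fun _ => y) * v - v)
      (CStarAlgebra.approximateUnit A) (𝓝 0) := by
    refine tendsto_zero_of_entries fun i j => ?_
    have h2 := (hu.tendsto_mul_right (v i j)).sub_const (v i j)
    rw [sub_self] at h2
    exact h2.congr fun y => by
      rw [← diagonalStarHom_mul_apply (fun _ => y) v i j]; rfl
  have h2 : Tendsto (fun y : A => diagonalStarHom ι A (fun _ => y) * v)
      (CStarAlgebra.approximateUnit A) (𝓝 v) := by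
    simpa using h1.add_const v
  have h3 := ((h2.star.mul h2).sub_const (star v * v)).norm
  rw [sub_self, norm_zero] at h3
  obtain ⟨y, ⟨hy0, hy1⟩, hy⟩ :=
    ((hu.eventually_nonneg.and hu.eventually_norm).and
      (h3.eventually (gt_mem_nhds hε))).exists
  exact ⟨y, hy0, hy1, hy.le⟩

section assembly

variable {G : Type*} [Group G] [Fintype G] {α : G → A ≃⋆ₐ[ℂ] A}

/-- Scalars realizing a common positive element by conjugating diagonal entries, in such a way
that the conjugates are almost orthogonal to their translates. -/
theorem WeakTracialRokhlin.exists_conjugators (hwtrp : WeakTracialRokhlin α)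
    (hA : IsSimpleCStarAlgebra A) {n : ℕ}
    {b vb : CStarMatrix (Fin n) (Fin n) A} (hb : b = star vb * vb)
    {K : Fin n → CStarMatrix (Fin n) (Fin n) A} (hK : ∀ i, IsSelfAdjoint (K i))
    (hKb : ∀ i j l, (K i * b * K i) j l ∈ fixedPts α) (hKb0 : ∀ i, K i * b * K i ≠ 0)
    {μ : ℝ} (hμ : 0 < μ) :
    ∃ (x : A) (j : Fin n → Fin n) (c : Fin n → A), 0 ≤ x ∧ ‖x‖ = 1 ∧
      (∀ i, c i * (K i * b * K i) (j i) (j i) * star (c i) = x) ∧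
      ∀ i s g, g ≠ 1 → ‖s * c i * (K i * b * K i) (j i) (j i) * star (α g (s * c i))‖ ≤
        μ * ‖s * x * star s‖ := by
  have e (i) : K i * b * K i = star (vb * K i) * (vb * K i) := by
    rw [star_mul, (hK i).star_eq, hb]; simp only [mul_assoc]
  have h1 (i) : ∃ j, 0 ≤ (K i * b * K i) j j ∧ (K i * b * K i) j j ≠ 0 := by
    have := hKb0 i
    rw [e] at this ⊢
    exact CStarMatrix.exists_diagonal_ne_zero this
  choose j hj0 hj1 using h1
  choose u hu0 hu using fun i =>
    hwtrp.exists_compression (hKb i (j i) (j i)) (hj0 i) (hj1 i) hμ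
  obtain ⟨x, hx, hx1, hq⟩ := hA.exists_common_conjugate_norm_eq_one
    (fun i => star (u i) * (K i * b * K i) (j i) (j i) * u i)
    (fun i => star_left_conjugate_nonneg (hj0 i) _) hu0
  choose q hq using hq
  refine ⟨x, j, fun i => q i * star (u i), hx, hx1, fun i => ?_, fun i s g hg => ?_⟩
  · rw [hq i]; simp only [star_mul, star_star, mul_assoc]
  · have h := hu i (s * q i) g hg
    convert h using 2
    · rw [← map_star]; simp only [star_mul, star_star, mul_assoc]
    · rw [hq i]; simp only [star_mul, mul_assoc]

/-- A sequential form of `WeakTracialRokhlin.exists_approx_sqrt`. -/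
theorem WeakTracialRokhlin.exists_approx_sqrt_seq (hwtrp : WeakTracialRokhlin α)
    (F : Finset A) {x y : A} (hx : 0 ≤ x) (hy : 0 ≤ y) (hx1 : ‖x‖ = 1) :
    ∃ (h : ℕ → G → A) (s : ℕ → A), (∀ k g, IsSelfAdjoint (h k g)) ∧ (∀ k g, ‖h k g‖ ≤ 1) ∧
      (∀ k g t, g ≠ t → h k g * h k t = 0) ∧
      (∀ g, ∀ a ∈ F, Tendsto (fun k => a * h k g - h k g * a) atTop (𝓝 0)) ∧
      (∀ g t, Tendsto (fun k => α g (h k t) - h k (g * t)) atTop (𝓝 0)) ∧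
      Tendsto (fun k => s k * x * star (s k) - (y * y - y * (∑ g, h k g * h k g) * y))
        atTop (𝓝 0) := by
  choose h s h1 h2 h3 h4 h5 h6 using fun k : ℕ =>
    hwtrp.exists_approx_sqrt (Nat.one_div_pos_of_nat (α := ℝ) (n := k)) F hx hy hx1
  have key {f : ℕ → A} (hf : ∀ k, ‖f k‖ < 1 / ((k : ℝ) + 1)) : Tendsto f atTop (𝓝 0) :=
    squeeze_zero_norm (fun k => (hf k).le) tendsto_one_div_add_atTop_nhds_zero_nat
  exact ⟨h, s, h1, h2, h3, fun g a ha => key fun k => h4 k g a ha, fun g t => key fun k => h5 k g t,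
    key h6⟩

/-- The entrywise action on matrices. -/
def matrixAction {G : Type*} (α : G → A ≃⋆ₐ[ℂ] A) (n : ℕ) (g : G) :
    CStarMatrix (Fin n) (Fin n) A →⋆ₙₐ[ℂ] CStarMatrix (Fin n) (Fin n) A :=
  CStarMatrix.mapₙₐ (α g : A →⋆ₙₐ[ℂ] A)

theorem matrixAction_eq_self_iff {G : Type*} {α : G → A ≃⋆ₐ[ℂ] A} {n : ℕ}
    {M : CStarMatrix (Fin n) (Fin n) A} :
    (∀ g, matrixAction α n g M = M) ↔ ∀ i j, M i j ∈ fixedPts α :=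
  ⟨fun h i j g => congrFun (congrFun (h g) i) j, fun h g => by ext i j; exact h i j g⟩

end assembly

theorem exists_bump_elements {B : Type*} [NonUnitalCStarAlgebra B] {b : B} (hb : IsSelfAdjoint b)
    (hsp : AccPt (0 : ℝ) (𝓟 (quasispectrum ℝ b))) (n : ℕ) {ε : ℝ} (hε : 0 < ε) :
    ∃ (C : B) (K : Fin n → B), IsSelfAdjoint C ∧ (∀ i, IsSelfAdjoint (K i)) ∧
      ‖C * b * C - b‖ ≤ ε ∧ (∀ i j, i ≠ j → K i * b * K j = 0) ∧ (∀ i, C * b * K i = 0) ∧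
      (∀ i, K i * b * K i ≠ 0) ∧
      ∀ φ : B →⋆ₙₐ[ℂ] B, φ b = b → φ C = C ∧ ∀ i, φ (K i) = K i := by
  obtain ⟨χ, k, ⟨hχ, hχ0⟩, hk, h1, h2, h3, h4⟩ := exists_spectral_bumps hb hsp n hε
  have hφ (φ : B →⋆ₙₐ[ℂ] B) (h : φ b = b) (f : ℝ → ℝ) (hf : Continuous f) (hf0 : f 0 = 0) :
      φ (cfcₙ f b) = cfcₙ f b := by
    have hc : Continuous φ := AddMonoidHomClass.continuous_of_bound φ 1 fun x => by
      simpa using NonUnitalStarAlgHom.norm_apply_le φ x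
    rw [NonUnitalStarAlgHomClass.map_cfcₙ (S := ℂ) φ f b hf.continuousOn hf0 hc hb (hb.map φ), h]
  exact ⟨cfcₙ χ b, fun i => cfcₙ (k i) b, cfcₙ_predicate _ _, fun i => cfcₙ_predicate _ _, h1, h2,
    h3, h4, fun φ h => ⟨hφ φ h _ hχ hχ0, fun i => hφ φ h _ (hk i).1 (hk i).2⟩⟩

section main

variable {G : Type*} [Group G] [Fintype G] {α : G → A ≃⋆ₐ[ℂ] A}

/-- Cuntz subequivalence descends to the fixed point algebra, up to a given tolerance. -/
theorem WeakTracialRokhlin.exists_fixed_approx (hwtrp : WeakTracialRokhlin α)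
    (hA : IsSimpleCStarAlgebra A) (hα : ∀ g h x, α (g * h) x = α g (α h x)) {n : ℕ}
    {a b v vb : CStarMatrix (Fin n) (Fin n) A} (ha : a = star v * v) (hb : b = star vb * vb)
    (haf : ∀ g, matrixAction α n g a = a) (hbf : ∀ g, matrixAction α n g b = b)
    (hsp : ∀ ε > 0, ∃ (C : CStarMatrix (Fin n) (Fin n) A)
      (K : Fin n → CStarMatrix (Fin n) (Fin n) A), IsSelfAdjoint C ∧ (∀ i, IsSelfAdjoint (K i)) ∧
      ‖C * b * C - b‖ ≤ ε ∧ (∀ i j, i ≠ j → K i * b * K j = 0) ∧ (∀ i, C * b * K i = 0) ∧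
      (∀ i, K i * b * K i ≠ 0) ∧ ∀ φ : CStarMatrix (Fin n) (Fin n) A →⋆ₙₐ[ℂ]
        CStarMatrix (Fin n) (Fin n) A, φ b = b → φ C = C ∧ ∀ i, φ (K i) = K i)
    (hle : ∀ ε > 0, ∃ w : CStarMatrix (Fin n) (Fin n) A, ‖w * b * star w - a‖ ≤ ε)
    {ε : ℝ} (hε : 0 < ε) :
    ∃ V : CStarMatrix (Fin n) (Fin n) A, (∀ g, matrixAction α n g V = V) ∧
      ‖V * b * star V - a‖ ≤ ε := by
  classical
  set N : ℝ := ((Fintype.card G : ℕ) : ℝ) with hN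
  have hN0 : 0 ≤ N := by positivity
  set β := matrixAction α n with hβ
  have hβapp (g : G) (M : CStarMatrix (Fin n) (Fin n) A) (i j : Fin n) :
      β g M i j = α g (M i j) := rfl
  set δ : ℝ := ε / (3 * N + 2) with hδ
  have hδ0 : 0 < δ := by positivity
  have hbs : IsSelfAdjoint b := hb ▸ IsSelfAdjoint.star_mul_self vb
  obtain ⟨w₀, hw₀⟩ := hle (δ / 2) (by positivity)
  obtain ⟨C, K, hC, hK, hCb, hKK, hCK, hKb0, hfix⟩ :=
    hsp (δ / 2 / (1 + ‖w₀‖ * ‖w₀‖)) (by positivity)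
  have hw : ‖w₀ * C * b * star (w₀ * C) - a‖ ≤ δ := by
    have e : w₀ * C * b * star (w₀ * C) - a =
        w₀ * (C * b * C - b) * star w₀ + (w₀ * b * star w₀ - a) := by
      rw [star_mul, hC.star_eq]; noncomm_ring
    rw [e]
    refine (norm_add_le _ _).trans ?_
    have h1 : ‖w₀ * (C * b * C - b) * star w₀‖ ≤ δ / 2 := by
      refine norm_mul₃_le.trans ?_
      rw [norm_star]
      have h2 : ‖w₀‖ * ‖C * b * C - b‖ * ‖w₀‖ ≤
          ‖w₀‖ * (δ / 2 / (1 + ‖w₀‖ * ‖w₀‖)) * ‖w₀‖ := by gcongr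
      refine h2.trans ?_
      rw [mul_div_assoc', div_mul_eq_mul_div, div_le_iff₀ (by positivity)]
      nlinarith [norm_nonneg w₀]
    linarith
  have hKf (g i) : β g (K i) = K i := (hfix (β g) (hbf g)).2 i
  have hKb (i j l) : (K i * b * K i) j l ∈ fixedPts α :=
    matrixAction_eq_self_iff.1 (fun g => by
      rw [map_mul, map_mul]
      rw [show matrixAction α n g (K i) = K i from hKf g i, hbf g]) j l
  set μ : ℝ := δ / ((N + 2) * (1 + ‖v‖ * ‖v‖)) with hμ
  have hμ0 : 0 < μ := by positivity
  obtain ⟨x, j, c, hx, hx1, hcx, hcross⟩ := hwtrp.exists_conjugators hA hb hK hKb hKb0 hμ0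
  obtain ⟨y, hy, hy1, hyv⟩ := CStarMatrix.exists_diagonal_compression v hδ0
  set D : A → CStarMatrix (Fin n) (Fin n) A :=
    fun z => CStarMatrix.diagonalStarHom (Fin n) A fun _ => z with hD
  have hDmul (z z' : A) : D z * D z' = D (z * z') := (map_mul _ _ _).symm
  have hDstar (z : A) : star (D z) = D (star z) := (map_star _ _).symm
  have hDsub (z z' : A) : D z - D z' = D (z - z') := (map_sub _ _ _).symm
  have hDnorm (z : A) : ‖D z‖ ≤ ‖z‖ :=
    CStarMatrix.norm_diagonalStarHom_le (norm_nonneg z) fun _ => le_rfl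
  have hDsum (f : G → A) : ∑ g, D (f g) = D (∑ g, f g) := by
    have e : (fun _ : Fin n => ∑ g, f g) = ∑ g, fun _ => f g := by ext; simp
    simp only [hD]
    rw [e, map_sum]
  have hDβ (g : G) (z : A) : β g (D z) = D (α g z) :=
    CStarMatrix.mapₙₐ_diagonalStarHom (α g : A →⋆ₙₐ[ℂ] A) _
  have hDtendsto {f : ℕ → A} (hf : Tendsto f atTop (𝓝 0)) :
      Tendsto (fun k => D (f k)) atTop (𝓝 0) :=
    squeeze_zero_norm (fun k => hDnorm (f k)) (tendsto_zero_iff_norm_tendsto_zero.1 hf)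
  set w := w₀ * C with hwdef
  set v₁ := D y * v with hv₁
  let F : Finset A :=
    (Finset.univ.image fun p : (G × G) × Fin n × Fin n =>
      (β p.1.1 w * b * star (β p.1.2 w)) p.2.1 p.2.2) ∪
    Finset.univ.image fun p : G × Fin n × Fin n => β p.1 v₁ p.2.1 p.2.2
  obtain ⟨h, s, hsa, hn1, ho, hcomm, htr, hs⟩ := hwtrp.exists_approx_sqrt_seq F hx hy hx1
  have hDcomm (M : CStarMatrix (Fin n) (Fin n) A) (hM : ∀ i l, M i l ∈ F) (g : G) :
      Tendsto (fun k => M * D (h k g) - D (h k g) * M) atTop (𝓝 0) := by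
    refine CStarMatrix.tendsto_zero_of_entries fun i l => (hcomm g _ (hM i l)).congr fun k => ?_
    rw [← CStarMatrix.mul_diagonalStarHom_apply (fun _ => h k g),
      ← CStarMatrix.diagonalStarHom_mul_apply (fun _ => h k g)]
    rfl
  let R : ℕ → CStarMatrix (Fin n) (Fin n) A := fun k =>
    ∑ i, star v * CStarMatrix.single i (j i) (s k * c i) * K i
  have hβR (g : G) (k : ℕ) : β g (R k) =
      ∑ i, star (β g v) * CStarMatrix.single i (j i) (α g (s k * c i)) * K i := by
    simp only [R, map_sum, map_mul, hKf, map_star]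
    refine Finset.sum_congr rfl fun i _ => ?_
    rw [← map_mul (α g)]
    congr 2
    exact CStarMatrix.mapₙₐ_single (α g : A →⋆ₙₐ[ℂ] A) i (j i) _
  have hRbR (k : ℕ) : R k * b * star (R k) = star v * D (s k * x * star (s k)) * v := by
    simp only [R]
    rw [CStarMatrix.sum_single_mul_star_sum_single hK hKK, star_star]
    simp only [hD]
    congr 3
    ext i
    rw [← hcx i]; simp only [star_mul, mul_assoc]
  have hRbβR (g : G) (k : ℕ) : R k * b * star (β g (R k)) = star v *
      CStarMatrix.diagonalStarHom (Fin n) A (fun i =>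
        s k * c i * (K i * b * K i) (j i) (j i) * star (α g (s k * c i))) * β g v := by
    rw [hβR]
    simp only [R]
    rw [CStarMatrix.sum_single_mul_star_sum_single hK hKK, star_star]
  have hwR (k : ℕ) (g t : G) : β g w * b * star (β t (R k)) = 0 := by
    rw [hβR, star_sum, Finset.mul_sum]
    refine Finset.sum_eq_zero fun i _ => ?_
    have e : β g w = β g w₀ * C := by rw [hwdef, map_mul, (hfix (β g) (hbf g)).1]
    rw [e, star_mul, star_mul, (hK i).star_eq,
      show ∀ z, β g w₀ * C * b * (K i * z) = β g w₀ * (C * b * K i) * z from fun z => by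
        simp only [mul_assoc], hCK]
    simp
  have hsum1 (k : ℕ) : ‖∑ g, h k g * h k g‖ ≤ N := by
    refine (norm_sum_le _ _).trans ((Finset.sum_le_card_nsmul _ _ 1 fun g _ => ?_).trans_eq ?_)
    · exact (norm_mul_le _ _).trans (mul_le_one₀ (hn1 k g) (norm_nonneg _) (hn1 k g))
    · rw [Finset.card_univ, nsmul_eq_mul, mul_one]
  have hsx : ∀ᶠ k in atTop, ‖s k * x * star (s k)‖ ≤ N + 2 := by
    filter_upwards [(tendsto_zero_iff_norm_tendsto_zero.1 hs).eventually (gt_mem_nhds zero_lt_one)]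
      with k hk
    have h1 : ‖y * y‖ ≤ 1 := (norm_mul_le _ _).trans (mul_le_one₀ hy1 (norm_nonneg _) hy1)
    have h2 : ‖y * (∑ g, h k g * h k g) * y‖ ≤ N := by
      refine norm_mul₃_le.trans ?_
      have := hsum1 k
      have h3 : ‖y‖ * ‖∑ g, h k g * h k g‖ * ‖y‖ ≤ 1 * N * 1 := by gcongr
      simpa using h3
    have h3 := norm_sub_le (y * y) (y * (∑ g, h k g * h k g) * y)
    have h4 := norm_le_norm_sub_add (s k * x * star (s k))
      (y * y - y * (∑ g, h k g * h k g) * y)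
    linarith
  have hV := exists_fixed_conjugate (β := β) (a := a) (b := b) (w := w) (v := v₁) (ε := δ)
    (H := fun k g => D (h k g)) (R := R) ?_ haf hbf hbs hδ0 hw (ha ▸ hyv) ?_ ?_ ?_ ?_ ?_ ?_ ?_ ?_ hwR
  · obtain ⟨V, hV, hVa⟩ := hV
    refine ⟨V, hV, hVa.trans_eq ?_⟩
    rw [hδ, mul_div_cancel₀]
    positivity
  · intro g t M
    ext i l
    exact hα g t _
  · intro k g
    rw [IsSelfAdjoint, hDstar, (hsa k g).star_eq]
  · exact fun k g => (hDnorm _).trans (hn1 k g)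
  · intro k g t hgt
    rw [hDmul, ho k g t hgt]
    exact map_zero (CStarMatrix.diagonalStarHom (Fin n) A)
  · intro g t
    simp only [hDβ, hDsub]
    exact hDtendsto (htr g t)
  · exact fun g t => hDcomm _ (fun i l => Finset.mem_union_left _
      (Finset.mem_image.2 ⟨((g, t), i, l), Finset.mem_univ _, rfl⟩)) g
  · exact fun g t => hDcomm _ (fun i l => Finset.mem_union_right _
      (Finset.mem_image.2 ⟨(g, i, l), Finset.mem_univ _, rfl⟩)) t
  · have h1 := (hDtendsto hs).const_mul (star v) |>.mul_const v
    rw [mul_zero, zero_mul] at h1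
    refine h1.congr fun k => ?_
    have hys : star y = y := (IsSelfAdjoint.of_nonneg hy).star_eq
    rw [hRbR, hv₁, star_mul, hDstar, hys, ← hDsub]
    simp only [hDmul, hDsum]
    have e1 : star v * D y * (D y * v) = star v * D (y * y) * v := by
      rw [← hDmul]; simp only [mul_assoc]
    have e2 (z : A) : star v * D y * D z * (D y * v) = star v * D (y * z * y) * v := by
      rw [← hDmul, ← hDmul]; simp only [mul_assoc]
    rw [e1, e2, ← hDsub, mul_sub, sub_mul, mul_sub, sub_mul]
  · filter_upwards [hsx] with k hk g hg
    rw [hRbβR]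
    refine norm_mul₃_le.trans ?_
    have h1 : ‖CStarMatrix.diagonalStarHom (Fin n) A (fun i =>
        s k * c i * (K i * b * K i) (j i) (j i) * star (α g (s k * c i)))‖ ≤ μ * (N + 2) :=
      CStarMatrix.norm_diagonalStarHom_le (by positivity) fun i =>
        (hcross i (s k) g hg).trans (by gcongr)
    have h2 : ‖β g v‖ ≤ ‖v‖ := NonUnitalStarAlgHom.norm_apply_le _ _
    rw [norm_star]
    have h3 : ‖v‖ * ‖CStarMatrix.diagonalStarHom (Fin n) A (fun i =>
        s k * c i * (K i * b * K i) (j i) (j i) * star (α g (s k * c i)))‖ * ‖β g v‖ ≤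
        ‖v‖ * (μ * (N + 2)) * ‖v‖ := by gcongr
    refine h3.trans ?_
    have h4 : ‖v‖ * (μ * (N + 2)) * ‖v‖ = δ * (‖v‖ * ‖v‖) / (1 + ‖v‖ * ‖v‖) := by
      rw [hμ]; field_simp
    rw [h4, div_le_iff₀ (by positivity)]
    nlinarith

end main

/-- One direction of the main theorem. -/
theorem WeakTracialRokhlin.cuntzLEMIn_fixedPts {G : Type*} [Group G] [Fintype G]
    {α : G → A ≃⋆ₐ[ℂ] A} (hwtrp : WeakTracialRokhlin α) (hA : IsSimpleCStarAlgebra A)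
    (hα : ∀ g h x, α (g * h) x = α g (α h x)) {n : ℕ} {a b : Matrix (Fin n) (Fin n) A}
    (hapos : ∃ v : Matrix (Fin n) (Fin n) A, a = star v * v)
    (hbpos : ∃ v : Matrix (Fin n) (Fin n) A, b = star v * v)
    (haent : ∀ i j, a i j ∈ fixedPts α) (hbent : ∀ i j, b i j ∈ fixedPts α)
    (hspb : AccPt (0 : ℝ) (𝓟 (quasispectrum ℝ b))) (hab : CuntzLEMIn Set.univ a b) :
    CuntzLEMIn {m : Matrix (Fin n) (Fin n) A | ∀ i j, m i j ∈ fixedPts α} a b := by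
  obtain ⟨v, ha⟩ := hapos
  obtain ⟨vb, hb⟩ := hbpos
  obtain ⟨w, -, hw⟩ := hab
  let a' : CStarMatrix (Fin n) (Fin n) A := a
  let b' : CStarMatrix (Fin n) (Fin n) A := b
  let w' : ℕ → CStarMatrix (Fin n) (Fin n) A := w
  have hw' : Tendsto (fun k => w' k * b' * star (w' k)) atTop (𝓝 a') := hw
  have hb' : b' = star (vb : CStarMatrix (Fin n) (Fin n) A) * vb := hb
  have hsp : AccPt (0 : ℝ) (𝓟 (quasispectrum ℝ b')) := hspb
  have hbs : IsSelfAdjoint b' := hb' ▸ IsSelfAdjoint.star_mul_self _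
  have hle (ε : ℝ) (hε : ε > 0) :
      ∃ u : CStarMatrix (Fin n) (Fin n) A, ‖u * b' * star u - a'‖ ≤ ε := by
    obtain ⟨k, hk⟩ := ((tendsto_iff_norm_sub_tendsto_zero.1 hw').eventually
      (gt_mem_nhds hε)).exists
    exact ⟨w' k, hk.le⟩
  choose V hV hVa using fun k : ℕ =>
    hwtrp.exists_fixed_approx hA hα (a := a') (b := b') (v := v) (vb := vb) ha hb'
      (matrixAction_eq_self_iff.2 haent) (matrixAction_eq_self_iff.2 hbent)
      (fun ε hε => exists_bump_elements hbs hsp n hε) hle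
      (Nat.one_div_pos_of_nat (α := ℝ) (n := k))
  have h : Tendsto (fun k => V k * b' * star (V k)) atTop (𝓝 a') :=
    tendsto_iff_norm_sub_tendsto_zero.2
      (squeeze_zero (fun k => norm_nonneg _) hVa tendsto_one_div_add_atTop_nhds_zero_nat)
  exact ⟨V, fun k => matrixAction_eq_self_iff.1 (hV k), h⟩

/-- Let `α` be an action of a finite group `G` on a simple
C*-algebra `A` with the weak tracial Rokhlin property.  For every `n` and all positive
`a, b ∈ Mₙ(A)` whose entries lie in `A^α`, such that `0` is an accumulation point of
the spectrum of `a` and of `b` (computed in the unitization, i.e. the quasispectrum),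
if `a` is Cuntz equivalent to `b` in `Mₙ(A)`, then `a` is Cuntz equivalent to `b` in
`Mₙ(A^α)`, i.e. the witnessing sequences can be taken with entries in `A^α`. -/
theorem cuntzEquiv_fixedPts_of_cuntzEquiv
    {G : Type*} [Group G] [Fintype G]
    (hA : IsSimpleCStarAlgebra A)
    (α : G → A ≃⋆ₐ[ℂ] A) (hα : ∀ g h x, α (g * h) x = α g (α h x))
    (hwtrp : WeakTracialRokhlin α)
    (n : ℕ) (a b : Matrix (Fin n) (Fin n) A)
    (hapos : ∃ v : Matrix (Fin n) (Fin n) A, a = star v * v)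
    (hbpos : ∃ v : Matrix (Fin n) (Fin n) A, b = star v * v)
    (haent : ∀ i j, a i j ∈ fixedPts α) (hbent : ∀ i j, b i j ∈ fixedPts α)
    (hspa : AccPt (0 : ℝ) (Filter.principal (quasispectrum ℝ a)))
    (hspb : AccPt (0 : ℝ) (Filter.principal (quasispectrum ℝ b)))
    (hab : CuntzLEMIn Set.univ a b ∧ CuntzLEMIn Set.univ b a) :
    CuntzLEMIn {m : Matrix (Fin n) (Fin n) A | ∀ i j, m i j ∈ fixedPts α} a b ∧
      CuntzLEMIn {m : Matrix (Fin n) (Fin n) A | ∀ i j, m i j ∈ fixedPts α} b a := by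
  exact ⟨hwtrp.cuntzLEMIn_fixedPts hA hα hapos hbpos haent hbent hspb hab.1,
    hwtrp.cuntzLEMIn_fixedPts hA hα hbpos hapos hbent haent hspa hab.2⟩
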